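/- Every planar triangle-free graph is 3-colorable. -/

import Mathlib

universe u
variable {V : Type u}



/-- A topological embedding (drawing) of a simple graph in a topological space `X`:
vertices map to distinct points, edges map to arcs meeting only at common endpoints. -/
structure GraphEmbeddingIn (X : Type*) [TopologicalSpace X] (G : SimpleGraph V) where
  vertexPos : V → X
  vertexInj : Function.Injective vertexPos
  edgeArc : ∀ u v : V, G.Adj u v → ℝ → X
  arc_cont : ∀ u v h, ContinuousOn (edgeArc u v h) (Set.Icc 0 1)
  arc_injOn : ∀ u v h, Set.InjOn (edgeArc u v h) (Set.Icc 0 1)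
  arc_start : ∀ u v h, edgeArc u v h 0 = vertexPos u
  arc_end : ∀ u v h, edgeArc u v h 1 = vertexPos v
  arc_avoid : ∀ u v h (w : V), vertexPos w ∉ edgeArc u v h '' Set.Ioo 0 1
  arc_disjoint : ∀ u v h u' v' h', s(u, v) ≠ s(u', v') →
    edgeArc u v h '' Set.Ioo 0 1 ∩ edgeArc u' v' h' '' Set.Icc 0 1 = ∅

/-- A graph is planar if it has a drawing in the plane. -/
def SimpleGraph.IsPlanar (G : SimpleGraph V) : Prop :=
  Nonempty (GraphEmbeddingIn (ℝ × ℝ) G)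

namespace SimpleGraph

open Finset

/-- `G` has a proper coloring with three colors on the vertex set `S`. -/
def ThreeColorableOn (G : SimpleGraph V) (S : Finset V) : Prop :=
  ∃ φ : V → Fin 3, ∀ a ∈ S, ∀ b ∈ S, G.Adj a b → φ a ≠ φ b

open scoped Classical in
/-- The ordered pairs of adjacent vertices of `S`. -/
noncomputable def dartsOn (G : SimpleGraph V) (S : Finset V) : Finset (V × V) :=
  (S ×ˢ S).filter fun p => G.Adj p.1 p.2

/-- Twice the Kostochka–Yancey potential `5 |S| - 3 |E(G[S])|`. -/
noncomputable def potential (G : SimpleGraph V) (S : Finset V) : ℤ :=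
  10 * #S - 3 * #(G.dartsOn S)

open scoped Classical in
/-- The neighbors of `v` in `S`. -/
noncomputable def neighborsOn (G : SimpleGraph V) (S : Finset V) (v : V) : Finset V :=
  S.filter fun w => G.Adj v w

variable {G : SimpleGraph V} {S R : Finset V}

@[simp]
lemma mem_dartsOn {p : V × V} : p ∈ G.dartsOn S ↔ (p.1 ∈ S ∧ p.2 ∈ S) ∧ G.Adj p.1 p.2 := by
  simp [dartsOn]

@[simp]
lemma mem_neighborsOn {v w : V} : w ∈ G.neighborsOn S v ↔ w ∈ S ∧ G.Adj v w := by
  simp [neighborsOn]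

lemma ThreeColorableOn.mono (h : G.ThreeColorableOn S) (hR : R ⊆ S) : G.ThreeColorableOn R := by
  obtain ⟨φ, hφ⟩ := h
  exact ⟨φ, fun a ha b hb => hφ a (hR ha) b (hR hb)⟩

lemma card_dartsOn_le (G : SimpleGraph V) (S : Finset V) : #(G.dartsOn S) ≤ #S * #S - #S := by
  classical
  rw [← offDiag_card]
  refine card_le_card fun p hp => ?_
  rw [mem_dartsOn] at hp
  exact mem_offDiag.2 ⟨hp.1.1, hp.1.2, hp.2.ne⟩

lemma card_dartsOn_eq_sum (G : SimpleGraph V) (S : Finset V) :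
    #(G.dartsOn S) = ∑ v ∈ S, #(G.neighborsOn S v) := by
  classical
  rw [card_eq_sum_card_fiberwise (f := Prod.fst) (t := S)
    (fun p hp => (mem_dartsOn.1 (mem_coe.1 hp)).1.1)]
  refine sum_congr rfl fun v hv => ?_
  refine card_bij (fun p _ => p.2) ?_ ?_ ?_
  · intro p hp
    rw [mem_filter, mem_dartsOn] at hp
    obtain ⟨⟨⟨_, h⟩, h'⟩, rfl⟩ := hp
    exact mem_neighborsOn.2 ⟨h, h'⟩
  · simp only [mem_filter]
    rintro p ⟨_, hp⟩ p' ⟨_, hp'⟩ h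
    exact Prod.ext (hp.trans hp'.symm) h
  · intro w hw
    rw [mem_neighborsOn] at hw
    exact ⟨(v, w), by simp [hv, hw.1, hw.2], rfl⟩

lemma threeColorableOn_of_card_le (G : SimpleGraph V) (h : #S ≤ 3) : G.ThreeColorableOn S := by
  classical
  obtain ⟨f⟩ : Nonempty (S ↪ Fin 3) := by
    apply Function.Embedding.nonempty_of_card_le
    simpa using h
  refine ⟨fun v => if hv : v ∈ S then f ⟨v, hv⟩ else 0, fun a ha b hb hab => ?_⟩
  simp only [ha, hb, dif_pos]
  intro h
  exact hab.ne (congrArg Subtype.val (f.injective h))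

/-- A coloring extends to a vertex with at most two colors on its neighborhood. -/
lemma exists_extend_coloring [DecidableEq V] {φ : V → Fin 3} {v : V} {c : Fin 3}
    (hφ : ∀ a ∈ S, ∀ b ∈ S, G.Adj a b → φ a ≠ φ b)
    (hc : ∀ w ∈ S, G.Adj v w → w ≠ v → φ w ≠ c) :
    ∀ a ∈ insert v S, ∀ b ∈ insert v S, G.Adj a b →
      Function.update φ v c a ≠ Function.update φ v c b := by
  intro a ha b hb hab
  have hne := hab.ne
  by_cases hav : a = v
  · subst hav
    have hb' : b ∈ S := (mem_insert.1 hb).resolve_left hne.symm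
    simpa [Function.update_of_ne hne.symm] using (hc b hb' hab hne.symm).symm
  · by_cases hbv : b = v
    · subst hbv
      have ha' : a ∈ S := (mem_insert.1 ha).resolve_left hne
      simpa [Function.update_of_ne hne] using hc a ha' hab.symm hne
    · rw [Function.update_of_ne hav, Function.update_of_ne hbv]
      exact hφ a ((mem_insert.1 ha).resolve_left hav) b ((mem_insert.1 hb).resolve_left hbv) hab

lemma exists_color_notMem (s : Finset (Fin 3)) (h : #s ≤ 2) : ∃ c, c ∉ s := by
  by_contra! hs
  have : s = univ := eq_univ_iff_forall.2 hs
  simp [this] at h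

/-- Colorings pull back along maps which are injective on edges. -/
lemma ThreeColorableOn.of_map {q : V → V} {S' : Finset V}
    (hq : ∀ a ∈ S, q a ∈ S') (hne : ∀ a ∈ S, ∀ b ∈ S, G.Adj a b → q a ≠ q b) {ψ : V → Fin 3}
    (hψ : ∀ a ∈ S', ∀ b ∈ S', (G.map q).Adj a b → ψ a ≠ ψ b) :
    ∀ a ∈ S, ∀ b ∈ S, G.Adj a b → (ψ ∘ q) a ≠ (ψ ∘ q) b := fun a ha b hb hab =>
  hψ _ (hq a ha) _ (hq b hb)
    ((SimpleGraph.map_adj' _ _ _ _).2 ⟨hne a ha b hb hab, a, b, hab, rfl, rfl⟩)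

/-- A vertex-critical graph `G[S]` violating the Kostochka–Yancey bound, while the bound holds for
all smaller graphs. -/
structure IsPotentialCounterexample (G : SimpleGraph V) (S : Finset V) : Prop where
  not_colorable : ¬ G.ThreeColorableOn S
  critical : ∀ R ⊂ S, G.ThreeColorableOn R
  potential_gt : 4 < G.potential S
  exists_of_card_lt : ∀ (G' : SimpleGraph V) (S' : Finset V), #S' < #S →
    ¬ G'.ThreeColorableOn S' → ∃ W ⊆ S', ¬ G'.ThreeColorableOn W ∧ G'.potential W ≤ 4

namespace IsPotentialCounterexample

/-- Collapsing the color classes of a coloring of `R` onto three vertices yields a non-colorable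
graph; a subgraph of it with small potential gives a superset `U` of `R` with small potential. Here
`C` is the set of colors whose class is used in that subgraph. -/
lemma exists_collapse (hS : G.IsPotentialCounterexample S) (hR : R ⊂ S) (hcard : 4 ≤ #R)
    {φ : V → Fin 3} (hφ : ∀ a ∈ R, ∀ b ∈ R, G.Adj a b → φ a ≠ φ b) :
    ∃ (U : Finset V) (C : Finset (Fin 3)), R ⊆ U ∧ U ⊆ S ∧ C.Nonempty ∧
      ∀ D ⊆ G.dartsOn U, (∀ p ∈ D, ¬ (p.1 ∈ R ∧ p.2 ∈ R) ∧
        ((p.1 ∈ R ∧ φ p.1 ∉ C) ∨ (p.2 ∈ R ∧ φ p.2 ∉ C))) →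
      G.potential U ≤ G.potential R + 4 - (10 * #C - 3 * (#C * #C - #C)) - 3 * #D := by
  classical
  obtain ⟨r⟩ : Nonempty (Fin 3 ↪ R) := by
    apply Function.Embedding.nonempty_of_card_le
    simp
    omega
  have hrinj : ∀ i j, (r i : V) = r j → i = j := fun i j h => r.injective (Subtype.ext h)
  set q : V → V := fun v => if v ∈ R then (r (φ v) : V) else v with hq
  have hqR : ∀ v ∈ R, q v = r (φ v) := fun v hv => by simp [hq, hv]
  have hqn : ∀ v, v ∉ R → q v = v := fun v hv => by simp [hq, hv]
  set X : Finset V := univ.image fun i => (r i : V) with hX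
  have hXR : X ⊆ R := by
    intro v hv
    obtain ⟨i, -, rfl⟩ := mem_image.1 hv
    exact (r i).2
  have hXcard : #X = 3 := by
    rw [hX, card_image_of_injective _ (fun i j h => hrinj i j h)]
    simp
  have hqX : ∀ v, q v ∈ X ↔ v ∈ R := by
    intro v
    by_cases hv : v ∈ R
    · simp [hqR v hv, hv, hX]
    · simp only [hqn v hv, hv, iff_false]
      exact fun h => hv (hXR h)
  have hqX' : ∀ v, q v ∉ X → q v = v := fun v hv => hqn v fun h => hv ((hqX v).2 h)
  have hS'card : #((S \ R) ∪ X) < #S := by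
    have h1 := card_union_le (S \ R) X
    have h2 := card_sdiff_add_card_eq_card hR.1
    omega
  have hproper : ∀ a ∈ S, ∀ b ∈ S, G.Adj a b → q a ≠ q b := by
    intro a ha b hb hab h
    by_cases haR : a ∈ R
    · by_cases hbR : b ∈ R
      · rw [hqR a haR, hqR b hbR] at h
        exact hφ a haR b hbR hab (hrinj _ _ h)
      · exact hbR ((hqX b).1 (h ▸ (hqX a).2 haR))
    · by_cases hbR : b ∈ R
      · exact haR ((hqX a).1 (h ▸ (hqX b).2 hbR))
      · rw [hqn a haR, hqn b hbR] at h
        exact hab.ne h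
  have hqS : ∀ a ∈ S, q a ∈ (S \ R) ∪ X := by
    intro a ha
    by_cases haR : a ∈ R
    · exact mem_union_right _ ((hqX a).2 haR)
    · rw [hqn a haR]
      exact mem_union_left _ (mem_sdiff.2 ⟨ha, haR⟩)
  obtain ⟨W, hWS', hWnc, hWpot⟩ := hS.exists_of_card_lt (G.map q) _ hS'card (by
    rintro ⟨ψ, hψ⟩
    exact hS.not_colorable ⟨_, ThreeColorableOn.of_map hqS hproper hψ⟩)
  set C : Finset (Fin 3) := univ.filter fun c => (r c : V) ∈ W with hC
  have hCcard : #(W ∩ X) = #C := by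
    refine (card_bij (fun c _ => (r c : V)) ?_ ?_ ?_).symm
    · intro c hc
      simp [hC] at hc
      simp [hc, hX]
    · exact fun c _ c' _ h => hrinj _ _ h
    · intro v hv
      rw [mem_inter] at hv
      obtain ⟨i, -, rfl⟩ := mem_image.1 hv.2
      exact ⟨i, by simp [hC, hv.1], rfl⟩
  have hlift : ∀ p : V × V, ∃ p' : V × V, (G.map q).Adj p.1 p.2 →
      G.Adj p'.1 p'.2 ∧ q p'.1 = p.1 ∧ q p'.2 = p.2 := by
    intro p
    by_cases hp : (G.map q).Adj p.1 p.2
    · obtain ⟨-, a, b, hab, ha, hb⟩ := (map_adj' _ _ _ _).1 hp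
      exact ⟨(a, b), fun _ => ⟨hab, ha, hb⟩⟩
    · exact ⟨p, fun h => absurd h hp⟩
  choose l hl using hlift
  refine ⟨(W \ X) ∪ R, C, subset_union_right, ?_, ?_, ?_⟩
  · refine union_subset ?_ hR.1
    intro v hv
    rw [mem_sdiff] at hv
    have := hWS' hv.1
    simp [hv.2] at this
    exact this.1
  · rw [← card_pos, ← hCcard, card_pos]
    by_contra hWX
    rw [not_nonempty_iff_eq_empty] at hWX
    have hWX' : ∀ v ∈ W, v ∉ X := fun v hv hvX => by
      have := mem_inter.2 ⟨hv, hvX⟩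
      simp [hWX] at this
    apply hWnc
    obtain ⟨ψ, hψ⟩ := hS.critical (S \ R) (by
      refine ⟨sdiff_subset, fun h => ?_⟩
      obtain ⟨v, hv⟩ : R.Nonempty := card_pos.1 (by omega)
      exact (mem_sdiff.1 (h (hR.1 hv))).2 hv)
    have hWSR : ∀ v ∈ W, v ∈ S \ R := fun v hv => by
      have := hWS' hv
      simpa [hWX' v hv] using this
    refine ⟨ψ, fun a ha b hb hab => ?_⟩
    obtain ⟨-, a', b', hab', rfl, rfl⟩ := (map_adj' _ _ _ _).1 hab
    have ha' := hqX' _ (hWX' _ ha)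
    have hb' := hqX' _ (hWX' _ hb)
    rw [ha'] at ha ⊢
    rw [hb'] at hb ⊢
    exact hψ _ (hWSR _ ha) _ (hWSR _ hb) hab'
  · intro D hD hDprop
    set T := ((G.map q).dartsOn W).filter fun p => ¬ (p.1 ∈ X ∧ p.2 ∈ X) with hT
    have hTcard : #((G.map q).dartsOn W) ≤ #T + (#C * #C - #C) := by
      rw [hT, ← card_filter_add_card_filter_not (s := (G.map q).dartsOn W)
        fun p => (p.1 ∈ X ∧ p.2 ∈ X), add_comm]
      gcongr
      rw [← hCcard]
      refine le_trans (card_le_card fun p hp => ?_) (card_dartsOn_le (G.map q) (W ∩ X))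
      simp only [mem_filter, mem_dartsOn, mem_inter] at hp ⊢
      tauto
    have hlT : ∀ p ∈ T, G.Adj (l p).1 (l p).2 ∧ q (l p).1 = p.1 ∧ q (l p).2 = p.2 := by
      intro p hp
      simp only [hT, mem_filter, mem_dartsOn] at hp
      exact hl p hp.1.2
    have hIcard : #(T.image l) = #T := by
      refine card_image_of_injOn fun p hp p' hp' h => ?_
      have h1 := hlT p hp
      have h2 := hlT p' hp'
      rw [h] at h1
      exact Prod.ext (h1.2.1.symm.trans h2.2.1) (h1.2.2.symm.trans h2.2.2)
    have hIprop : ∀ p ∈ T.image l, G.Adj p.1 p.2 ∧ q p.1 ∈ W ∧ q p.2 ∈ W ∧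
        ¬ (p.1 ∈ R ∧ p.2 ∈ R) := by
      intro p hp
      obtain ⟨p', hp', rfl⟩ := mem_image.1 hp
      obtain ⟨h1, h2, h3⟩ := hlT p' hp'
      simp only [hT, mem_filter, mem_dartsOn] at hp'
      refine ⟨h1, h2 ▸ hp'.1.1.1, h3 ▸ hp'.1.1.2, ?_⟩
      rw [← hqX, ← hqX, h2, h3]
      exact hp'.2
    have hqU : ∀ v, q v ∈ W → v ∈ (W \ X) ∪ R := by
      intro v hv
      by_cases hvR : v ∈ R
      · exact mem_union_right _ hvR
      · rw [hqn v hvR] at hv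
        exact mem_union_left _ (mem_sdiff.2 ⟨hv, fun h => hvR (hXR h)⟩)
    have hqC : ∀ v ∈ R, q v ∈ W → φ v ∈ C := by
      intro v hv hvW
      rw [hqR v hv] at hvW
      simp [hC, hvW]
    have hd1 : Disjoint (G.dartsOn R) D := by
      rw [Finset.disjoint_left]
      intro p hp hpD
      exact (hDprop p hpD).1 (mem_dartsOn.1 hp).1
    have hd2 : Disjoint (G.dartsOn R ∪ D) (T.image l) := by
      rw [Finset.disjoint_left]
      intro p hp hpI
      obtain ⟨h1, h2, h3, h4⟩ := hIprop p hpI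
      rcases mem_union.1 hp with hp | hp
      · exact h4 (mem_dartsOn.1 hp).1
      · rcases (hDprop p hp).2 with h | h
        · exact h.2 (hqC _ h.1 h2)
        · exact h.2 (hqC _ h.1 h3)
    have hsub : (G.dartsOn R ∪ D) ∪ T.image l ⊆ G.dartsOn ((W \ X) ∪ R) := by
      refine union_subset (union_subset ?_ hD) ?_
      · intro p hp
        rw [mem_dartsOn] at hp ⊢
        exact ⟨⟨mem_union_right _ hp.1.1, mem_union_right _ hp.1.2⟩, hp.2⟩
      · intro p hp
        obtain ⟨h1, h2, h3, h4⟩ := hIprop p hp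
        exact mem_dartsOn.2 ⟨⟨hqU _ h2, hqU _ h3⟩, h1⟩
    have hcards := card_le_card hsub
    rw [card_union_of_disjoint hd2, card_union_of_disjoint hd1, hIcard] at hcards
    have hU : #((W \ X) ∪ R) + #C ≤ #W + #R := by
      have h1 := card_union_le (W \ X) R
      have h2 := card_sdiff_add_card_inter W X
      omega
    have hCC : #C ≤ #C * #C := Nat.le_mul_self _
    have hTcard' : (#((G.map q).dartsOn W) : ℤ) ≤ #T + (#C * #C - #C) := by
      have := (Nat.cast_le (α := ℤ)).2 hTcard
      push_cast [Nat.cast_sub hCC] at this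
      exact this
    unfold potential at hWpot ⊢
    zify at hcards hU
    linarith

lemma card_bound_of_le_three {k : ℕ} (h0 : 1 ≤ k) (h : k ≤ 3) :
    (10 : ℤ) ≤ 10 * k - 3 * (k * k - k) := by
  interval_cases k <;> norm_num

lemma card_bound_of_two_le {k : ℕ} (h0 : 2 ≤ k) (h : k ≤ 3) :
    (12 : ℤ) ≤ 10 * k - 3 * (k * k - k) := by
  interval_cases k <;> norm_num

lemma potential_ge_of_card (G : SimpleGraph V) (R : Finset V) :
    10 * (#R : ℤ) - 3 * (#R * #R - #R) ≤ G.potential R := by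
  have h := G.card_dartsOn_le R
  have h' := (Nat.cast_le (α := ℤ)).2 h
  push_cast [Nat.cast_sub (Nat.le_mul_self #R)] at h'
  unfold potential
  linarith

lemma card_fin_three_le (C : Finset (Fin 3)) : #C ≤ 3 := by
  simpa using card_le_univ C

lemma potential_gt_ten (hS : G.IsPotentialCounterexample S) (hR : R ⊂ S) (hcard : 2 ≤ #R) :
    10 < G.potential R := by
  classical
  by_contra! hpot
  obtain ⟨R₀, hR₀, hmin⟩ := exists_min_image
    (S.powerset.filter fun T => T ≠ S ∧ 2 ≤ #T) G.potential
    ⟨R, by simp [hR.1, hR.ne, hcard]⟩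
  simp only [mem_filter, mem_powerset] at hR₀ hmin
  have hpot₀ : G.potential R₀ ≤ 10 := (hmin R ⟨hR.1, hR.ne, hcard⟩).trans hpot
  have hR₀S : R₀ ⊂ S := Finset.ssubset_iff_subset_ne.2 ⟨hR₀.1, hR₀.2.1⟩
  have h4 : 4 ≤ #R₀ := by
    by_contra! h
    have := card_bound_of_two_le hR₀.2.2 (by omega)
    have := potential_ge_of_card G R₀
    linarith
  obtain ⟨φ, hφ⟩ := hS.critical R₀ hR₀S
  obtain ⟨U, C, hRU, hUS, hC, h⟩ := hS.exists_collapse hR₀S h4 hφ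
  have hU := h ∅ (empty_subset _) (by simp)
  have hk := card_bound_of_le_three (card_pos.2 hC) (card_fin_three_le C)
  rw [card_empty] at hU
  by_cases hUS' : U = S
  · subst hUS'
    have := hS.potential_gt
    push_cast at hU
    linarith
  · have := hmin U ⟨hUS, hUS', hR₀.2.2.trans (card_le_card hRU)⟩
    push_cast at hU
    linarith

/-- Proper subgraphs of a counterexample stay colorable after adding an edge. -/
lemma exists_coloring_ne (hS : G.IsPotentialCounterexample S) (hR : R ⊂ S) {u v : V}
    (hu : u ∈ R) (hv : v ∈ R) (huv : u ≠ v) :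
    ∃ φ : V → Fin 3, (∀ a ∈ R, ∀ b ∈ R, G.Adj a b → φ a ≠ φ b) ∧ φ u ≠ φ v := by
  classical
  by_cases hcol : (G ⊔ edge u v).ThreeColorableOn R
  · obtain ⟨φ, hφ⟩ := hcol
    exact ⟨φ, fun a ha b hb hab => hφ a ha b hb (Or.inl hab),
      hφ u hu v hv (Or.inr (by simp [edge_adj, huv]))⟩
  · exfalso
    obtain ⟨W, hWR, hWnc, hW⟩ := hS.exists_of_card_lt _ R (card_lt_card hR) hcol
    have hsub : (G ⊔ edge u v).dartsOn W ⊆ G.dartsOn W ∪ {(u, v), (v, u)} := by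
      rintro ⟨a, b⟩ hp
      simp only [mem_dartsOn, sup_adj, edge_adj, mem_union, mem_insert, mem_singleton,
        Prod.mk.injEq] at hp ⊢
      tauto
    have hc : #((G ⊔ edge u v).dartsOn W) ≤ #(G.dartsOn W) + 2 :=
      (card_le_card hsub).trans ((card_union_le _ _).trans (by gcongr; exact card_le_two))
    have hW2 : 2 ≤ #W := by
      by_contra! h
      exact hWnc (threeColorableOn_of_card_le _ (by omega))
    have := hS.potential_gt_ten (Finset.ssubset_of_subset_of_ssubset hWR hR) hW2
    unfold potential at this hW
    zify at hc
    linarith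

/-- The vertices of `R` which have a neighbor outside of `R`. -/
lemma exists_two_boundary (hS : G.IsPotentialCounterexample S) (hR : R ⊂ S) (hcard : 2 ≤ #R) :
    ∃ u ∈ R, ∃ v ∈ R, u ≠ v ∧ (∃ b ∈ S, b ∉ R ∧ G.Adj u b) ∧ (∃ b ∈ S, b ∉ R ∧ G.Adj v b) := by
  classical
  by_contra! hcon
  obtain ⟨u, hu, hub⟩ : ∃ u ∈ R, ∀ v ∈ R, ∀ b ∈ S, b ∉ R → G.Adj v b → v = u := by
    by_cases h : ∃ u ∈ R, ∃ b ∈ S, b ∉ R ∧ G.Adj u b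
    · obtain ⟨u, hu, hb⟩ := h
      refine ⟨u, hu, fun v hv b hbS hbR hvb => ?_⟩
      by_contra hne
      exact hcon u hu v hv (Ne.symm hne) hb b hbS hbR hvb
    · push Not at h
      obtain ⟨u, hu⟩ : R.Nonempty := card_pos.1 (by omega)
      exact ⟨u, hu, fun v hv b hbS hbR hvb => absurd hvb (h v hv b hbS hbR)⟩
  obtain ⟨φ, hφ⟩ := hS.critical R hR
  obtain ⟨ψ, hψ⟩ := hS.critical (insert u (S \ R)) (by
    refine Finset.ssubset_iff_subset_ne.2 ⟨insert_subset (hR.1 hu) sdiff_subset, fun h => ?_⟩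
    obtain ⟨w, hw, hwu⟩ := exists_mem_ne (by omega : 1 < #R) u
    have := h ▸ hR.1 hw
    simp [hwu, hw] at this)
  let σ := Equiv.swap (ψ u) (φ u)
  have hσ : σ (ψ u) = φ u := Equiv.swap_apply_left _ _
  refine hS.not_colorable ⟨fun v => if v ∈ R then φ v else σ (ψ v), ?_⟩
  have key : ∀ a ∈ S, ∀ b ∈ S, a ∈ R → b ∉ R → G.Adj a b → φ a ≠ σ (ψ b) := by
    intro a ha b hb haR hbR hab
    obtain rfl := hub a haR b hb hbR hab
    rw [← hσ]
    exact fun h => hψ a (mem_insert_self _ _) b (by simp [hb, hbR]) hab (σ.injective h)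
  intro a ha b hb hab
  by_cases haR : a ∈ R <;> by_cases hbR : b ∈ R <;> simp only [haR, hbR, if_true, if_false]
  · exact hφ a haR b hbR hab
  · exact key a ha b hb haR hbR hab
  · exact (key b hb a ha hbR haR hab.symm).symm
  · exact fun h => hψ a (by simp [ha, haR]) b (by simp [hb, hbR]) hab (σ.injective h)

lemma potential_gt_twelve (hS : G.IsPotentialCounterexample S) (hR : R ⊂ S) (hcard : 4 ≤ #R) :
    12 < G.potential R := by
  classical
  by_contra! hpot
  obtain ⟨u, hu, v, hv, huv, ⟨b, hbS, hbR, hub⟩, ⟨c, hcS, hcR, hvc⟩⟩ :=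
    hS.exists_two_boundary hR (by omega)
  obtain ⟨φ, hφ, hφuv⟩ := hS.exists_coloring_ne hR hu hv huv
  obtain ⟨U, C, hRU, hUS, hC, h⟩ := hS.exists_collapse hR hcard hφ
  have hU := h ∅ (empty_subset _) (by simp)
  have hk := card_bound_of_le_three (card_pos.2 hC) (card_fin_three_le C)
  rw [card_empty] at hU
  push_cast at hU
  by_cases hUS' : U = S
  · subst hUS'
    have hgt := hS.potential_gt
    have hC1 : #C = 1 := by
      by_contra hne
      have := card_bound_of_two_le (by have := card_pos.2 hC; omega) (card_fin_three_le C)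
      linarith
    obtain ⟨w, hw, d, hdU, hdR, hwd, hwC⟩ : ∃ w ∈ R, ∃ d ∈ U, d ∉ R ∧ G.Adj w d ∧ φ w ∉ C := by
      obtain ⟨i, rfl⟩ := card_eq_one.1 hC1
      by_cases hui : φ u = i
      · exact ⟨v, hv, c, hcS, hcR, hvc, by
          rw [mem_singleton]
          exact fun h => hφuv (hui.trans h.symm)⟩
      · exact ⟨u, hu, b, hbS, hbR, hub, by rwa [mem_singleton]⟩
    have hU' := h {(w, d), (d, w)} (by
      intro p hp
      rw [mem_insert, mem_singleton] at hp
      rcases hp with rfl | rfl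
      · exact mem_dartsOn.2 ⟨⟨hRU hw, hdU⟩, hwd⟩
      · exact mem_dartsOn.2 ⟨⟨hdU, hRU hw⟩, hwd.symm⟩) (by
      intro p hp
      rw [mem_insert, mem_singleton] at hp
      rcases hp with rfl | rfl <;> simp [hw, hdR, hwC])
    rw [card_pair (fun h => hwd.ne (congrArg Prod.fst h))] at hU'
    push_cast at hU'
    linarith
  · have := hS.potential_gt_ten (Finset.ssubset_iff_subset_ne.2 ⟨hUS, hUS'⟩)
      ((by omega : 2 ≤ #R).trans (card_le_card hRU))
    linarith

lemma three_le_card_neighborsOn (hS : G.IsPotentialCounterexample S) {v : V} (hv : v ∈ S) :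
    3 ≤ #(G.neighborsOn S v) := by
  classical
  by_contra! h
  obtain ⟨φ, hφ⟩ := hS.critical (S.erase v) (erase_ssubset hv)
  obtain ⟨c, hc⟩ := exists_color_notMem ((G.neighborsOn S v).image φ)
    (card_image_le.trans (by omega))
  have := exists_extend_coloring (v := v) (c := c) hφ (fun w hw hvw _ h => hc
    (mem_image.2 ⟨w, by simp [hvw, mem_of_mem_erase hw], h⟩))
  rw [insert_erase hv] at this
  exact hS.not_colorable ⟨_, this⟩

lemma five_le_card (hS : G.IsPotentialCounterexample S) : 5 ≤ #S := by
  by_contra! h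
  have h4 : 4 ≤ #S := by
    by_contra! h3
    exact hS.not_colorable (threeColorableOn_of_card_le _ (by omega))
  have hsum : #S * 3 ≤ #(G.dartsOn S) := by
    rw [card_dartsOn_eq_sum, ← smul_eq_mul]
    exact card_nsmul_le_sum _ _ _ fun v hv => hS.three_le_card_neighborsOn hv
  have hgt := hS.potential_gt
  unfold potential at hgt
  omega

/-- In a counterexample, a triangle does not contain two vertices of degree three. -/
lemma not_triangle (hS : G.IsPotentialCounterexample S) {x y z : V} (hx : x ∈ S) (hy : y ∈ S)
    (hz : z ∈ S) (hdx : #(G.neighborsOn S x) = 3) (hdy : #(G.neighborsOn S y) = 3)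
    (hxy : G.Adj x y) (hxz : G.Adj x z) (hyz : G.Adj y z) : False := by
  classical
  have third : ∀ {x y : V}, y ∈ S → #(G.neighborsOn S x) = 3 → G.Adj x y → G.Adj x z →
      y ≠ z → ∃ x', x' ≠ y ∧ x' ≠ z ∧ G.neighborsOn S x = {y, z, x'} := by
    intro x y hy hdx hxy hxz hyz
    have h1 : ({y, z} : Finset V) ⊆ G.neighborsOn S x := by
      intro w hw
      rw [mem_insert, mem_singleton] at hw
      rcases hw with rfl | rfl
      · simp [hy, hxy]
      · simp [hz, hxz]
    have h2 : #(G.neighborsOn S x \ {y, z}) = 1 := by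
      rw [card_sdiff_of_subset h1, hdx, card_pair hyz]
    obtain ⟨x', hx'⟩ := card_eq_one.1 h2
    have hx'' : x' ∈ G.neighborsOn S x \ {y, z} := by simp [hx']
    simp only [mem_sdiff, mem_insert, mem_singleton, not_or] at hx''
    refine ⟨x', hx''.2.1, hx''.2.2, ?_⟩
    rw [← sdiff_union_of_subset h1, hx']
    ext w
    simp
    tauto
  obtain ⟨x', hx'y, hx'z, hNx⟩ := third hy hdx hxy hxz hyz.ne
  obtain ⟨y', hy'x, hy'z, hNy⟩ := third hx hdy hxy.symm hyz hxz.ne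
  have hx' : x' ∈ S ∧ G.Adj x x' := by
    rw [← mem_neighborsOn, hNx]
    simp
  have hy' : y' ∈ S ∧ G.Adj y y' := by
    rw [← mem_neighborsOn, hNy]
    simp
  have hne : x' ≠ y' := by
    rintro rfl
    have hc : #({x, y, z, x'} : Finset V) = 4 := by
      rw [card_insert_of_notMem, card_insert_of_notMem, card_pair hx'z.symm]
      · simp [hyz.ne, hx'y.symm]
      · simp [hxy.ne, hxz.ne, hy'x.symm]
    have hsub : ({x, y, z, x'} : Finset V) ⊆ S := by
      intro w hw
      simp only [mem_insert, mem_singleton] at hw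
      rcases hw with rfl | rfl | rfl | rfl
      exacts [hx, hy, hz, hx'.1]
    have hpot := hS.potential_gt_ten (R := {x, y, z, x'})
      (Finset.ssubset_iff_subset_ne.2 ⟨hsub, fun h => by
        have := hS.five_le_card
        rw [← h] at this
        omega⟩) (by omega)
    have hdarts : ({(x, y), (y, x), (x, z), (z, x), (x, x'), (x', x), (y, z), (z, y), (y, x'),
        (x', y)} : Finset (V × V)) ⊆ G.dartsOn {x, y, z, x'} := by
      intro p hp
      simp only [mem_insert, mem_singleton] at hp
      rcases hp with rfl | rfl | rfl | rfl | rfl | rfl | rfl | rfl | rfl | rfl <;>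
        simp [hxy, hxz, hyz, hx'.2, hy'.2, hxy.symm, hxz.symm, hyz.symm, hx'.2.symm, hy'.2.symm]
    have hdc := card_le_card hdarts
    have h10 : #({(x, y), (y, x), (x, z), (z, x), (x, x'), (x', x), (y, z), (z, y), (y, x'),
        (x', y)} : Finset (V × V)) = 10 := by
      have h1 := hxy.ne
      have h2 := hxz.ne
      have h3 := hyz.ne
      have h4 := hx'.2.ne
      have h5 := hy'.2.ne
      repeat rw [card_insert_of_notMem]
      · simp
      all_goals simp [h1, h2, h3, h4, h5, h1.symm, h2.symm, h3.symm, h4.symm, h5.symm, hx'z,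
        hx'z.symm]
    unfold potential at hpot
    rw [hc] at hpot
    push_cast at hpot
    omega
  obtain ⟨φ, hφ, hφne⟩ := hS.exists_coloring_ne (R := (S.erase x).erase y)
    (Finset.ssubset_of_subset_of_ssubset (erase_subset _ _) (erase_ssubset hx))
    (u := x') (v := y') (by simp [hx'.1, hx'y, hx'.2.ne.symm])
    (by simp [hy'.1, hy'x, hy'.2.ne.symm])
    hne
  obtain ⟨c, d, hcz, hcx, hdz, hdy, hcd⟩ : ∃ c d : Fin 3,
      c ≠ φ z ∧ c ≠ φ x' ∧ d ≠ φ z ∧ d ≠ φ y' ∧ c ≠ d := by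
    generalize φ z = a at *
    generalize φ x' = b at *
    generalize φ y' = e at *
    revert a b e
    decide
  have h1 := exists_extend_coloring (v := y) (c := d) hφ (by
    intro w hw hyw hwy
    have : w ∈ G.neighborsOn S y := by
      simp [hyw, mem_of_mem_erase (mem_of_mem_erase hw)]
    rw [hNy] at this
    simp only [mem_insert, mem_singleton] at this
    rcases this with rfl | rfl | rfl
    · simp at hw
    · exact hdz.symm
    · exact hdy.symm)
  rw [insert_erase (by simp [hy, hxy.ne.symm])] at h1
  have h2 := exists_extend_coloring (v := x) (c := c) h1 (by
    intro w hw hxw hwx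
    have : w ∈ G.neighborsOn S x := by
      simp [hxw, mem_of_mem_erase hw]
    rw [hNx] at this
    simp only [mem_insert, mem_singleton] at this
    rcases this with rfl | rfl | rfl
    · simpa using hcd.symm
    · rw [Function.update_of_ne hyz.ne.symm]
      exact hcz.symm
    · rw [Function.update_of_ne hx'y]
      exact hcx.symm)
  rw [insert_erase hx] at h2
  exact hS.not_colorable ⟨_, h2⟩

/-- In a counterexample, the other two neighbors of a vertex of degree three with a neighbor of
degree three are adjacent. -/
lemma adj_of_degree_three (hS : G.IsPotentialCounterexample S) {x y u v : V} (hx : x ∈ S)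
    (hy : y ∈ S) (hdy : #(G.neighborsOn S y) = 3)
    (mem_x : ∀ w, w ∈ S ∧ G.Adj x w ↔ w = y ∨ w = u ∨ w = v) (hyu : y ≠ u) (hyv : y ≠ v)
    (huv : u ≠ v) : G.Adj u v := by
  classical
  by_contra hnadj
  obtain ⟨-, hxy⟩ := (mem_x y).2 (by simp)
  obtain ⟨hu, hxu⟩ := (mem_x u).2 (by simp)
  obtain ⟨hv, hxv⟩ := (mem_x v).2 (by simp)
  set q : V → V := fun w => if w = v then u else w with hq
  have hqv : q v = u := by simp [hq]
  have hqn : ∀ w, w ≠ v → q w = w := fun w hw => by simp [hq, hw]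
  have hqu : q u = u := hqn u huv
  set S₀ := (S.erase x).erase y with hS₀
  set S' := S₀.erase v with hS'
  have hproper : ∀ a ∈ S₀, ∀ b ∈ S₀, G.Adj a b → q a ≠ q b := by
    intro a _ b _ hab h
    by_cases hav : a = v
    · have hbv : b ≠ v := fun h => hab.ne (hav.trans h.symm)
      rw [hav, hqv, hqn b hbv] at h
      exact hnadj (h ▸ hav ▸ hab.symm)
    · by_cases hbv : b = v
      · rw [hbv, hqv, hqn a hav] at h
        exact hnadj (h ▸ hbv ▸ hab)
      · rw [hqn a hav, hqn b hbv] at h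
        exact hab.ne h
  have hqS : ∀ a ∈ S₀, q a ∈ S' := by
    intro a ha
    by_cases hav : a = v
    · rw [hav, hqv]
      simp [hS', hS₀, huv, hyu.symm, hu, hxu.ne.symm]
    · rw [hqn a hav]
      exact mem_erase.2 ⟨hav, ha⟩
  have hcardlt : #S' < #S := card_lt_card (Finset.ssubset_of_subset_of_ssubset
    ((erase_subset _ _).trans (erase_subset _ _)) (erase_ssubset hx))
  obtain ⟨W, hWS', hWnc, hW⟩ := hS.exists_of_card_lt (G.map q) S' hcardlt (by
    rintro ⟨ψ, hψ⟩
    have h0 := ThreeColorableOn.of_map hqS hproper hψ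
    obtain ⟨c, hc⟩ := exists_color_notMem (((G.neighborsOn S y).erase x).image (ψ ∘ q)) (by
      refine card_image_le.trans ?_
      rw [card_erase_of_mem (by simp [hx, hxy.symm]), hdy])
    have h1 := exists_extend_coloring (v := y) (c := c) h0 (by
      intro w hw hyw _ h
      refine hc (mem_image.2 ⟨w, ?_, h⟩)
      simp only [hS₀, mem_erase] at hw
      simp [hw.2.1, hw.2.2, hyw])
    rw [hS₀, insert_erase (by simp [hy, hxy.ne.symm])] at h1
    obtain ⟨d, hd⟩ := exists_color_notMem {c, ψ u} card_le_two
    simp only [mem_insert, mem_singleton, not_or] at hd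
    have h2 := exists_extend_coloring (v := x) (c := d) h1 (by
      intro w hw hxw _
      rcases (mem_x w).1 ⟨mem_of_mem_erase hw, hxw⟩ with rfl | rfl | rfl
      · simpa using Ne.symm hd.1
      · rw [Function.update_of_ne hyu.symm, Function.comp_apply, hqu]
        exact Ne.symm hd.2
      · rw [Function.update_of_ne hyv.symm, Function.comp_apply, hqv]
        exact Ne.symm hd.2)
    rw [insert_erase hx] at h2
    exact hS.not_colorable ⟨_, h2⟩)
  have hvW : v ∉ W := fun h => by simpa [hS'] using hWS' h
  have hxW : x ∉ W := fun h => by simpa [hS', hS₀] using hWS' h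
  have hyW : y ∉ W := fun h => by simpa [hS', hS₀] using hWS' h
  have hWS : W ⊆ S := fun w hw => by
    have := hWS' hw
    simp only [hS', hS₀, mem_erase] at this
    exact this.2.2.2
  have huW : u ∈ W := by
    by_contra huW
    obtain ⟨ψ, hψ⟩ := hS.critical W (Finset.ssubset_iff_subset_ne.2 ⟨hWS, fun h => hxW (h ▸ hx)⟩)
    have hpre : ∀ a, q a ∈ W → q a = a := fun a ha => hqn a fun h => huW (hqv ▸ h ▸ ha)
    refine hWnc ⟨ψ, fun a ha b hb hab => ?_⟩
    obtain ⟨-, a', b', hab', rfl, rfl⟩ := (map_adj' _ _ _ _).1 hab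
    have ha' := hpre _ ha
    have hb' := hpre _ hb
    rw [ha'] at ha ⊢
    rw [hb'] at hb ⊢
    exact hψ _ ha _ hb hab'
  have hW2 : 2 ≤ #W := by
    by_contra! h
    exact hWnc (threeColorableOn_of_card_le _ (by omega))
  have hcard : #(insert x (insert v W)) = #W + 2 := by
    rw [card_insert_of_notMem, card_insert_of_notMem hvW]
    simp [hxv.ne, hxW]
  have hpot := hS.potential_gt_twelve (R := insert x (insert v W))
    (Finset.ssubset_iff_subset_ne.2 ⟨insert_subset hx (insert_subset hv hWS), fun h => by
      rw [← h] at hy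
      simp [hxy.ne.symm, hyv, hyW] at hy⟩) (by omega)
  have hlift : ∀ p : V × V, ∃ p' : V × V, p ∈ (G.map q).dartsOn W →
      G.Adj p'.1 p'.2 ∧ q p'.1 = p.1 ∧ q p'.2 = p.2 := by
    intro p
    by_cases hp : p ∈ (G.map q).dartsOn W
    · obtain ⟨-, a, b, hab, ha, hb⟩ := (map_adj' _ _ _ _).1 (mem_dartsOn.1 hp).2
      exact ⟨(a, b), fun _ => ⟨hab, ha, hb⟩⟩
    · exact ⟨p, fun h => absurd h hp⟩
  choose l hl using hlift
  have hlcard : #(((G.map q).dartsOn W).image l) = #((G.map q).dartsOn W) := by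
    refine card_image_of_injOn fun p hp p' hp' h => ?_
    have h1 := hl p hp
    have h2 := hl p' hp'
    rw [h] at h1
    exact Prod.ext (h1.2.1.symm.trans h2.2.1) (h1.2.2.symm.trans h2.2.2)
  have hpre : ∀ a, q a ∈ W → a ∈ insert v W ∧ a ≠ x := by
    intro a ha
    by_cases hav : a = v
    · exact ⟨by simp [hav], hav ▸ hxv.ne.symm⟩
    · rw [hqn a hav] at ha
      exact ⟨by simp [ha], fun h => hxW (h ▸ ha)⟩
  have hIprop : ∀ p ∈ ((G.map q).dartsOn W).image l,
      G.Adj p.1 p.2 ∧ q p.1 ∈ W ∧ q p.2 ∈ W := by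
    intro p hp
    obtain ⟨p', hp', rfl⟩ := mem_image.1 hp
    obtain ⟨h1, h2, h3⟩ := hl p' hp'
    rw [mem_dartsOn] at hp'
    exact ⟨h1, h2 ▸ hp'.1.1, h3 ▸ hp'.1.2⟩
  have hdisj : _root_.Disjoint (((G.map q).dartsOn W).image l)
      ({(x, u), (u, x), (x, v), (v, x)} : Finset (V × V)) := by
    rw [Finset.disjoint_left]
    intro p hp hp'
    obtain ⟨h1, h2, h3⟩ := hIprop p hp
    have h4 := (hpre _ h2).2
    have h5 := (hpre _ h3).2
    simp only [mem_insert, mem_singleton] at hp'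
    rcases hp' with rfl | rfl | rfl | rfl <;> simp at h4 h5
  have hsub : ((G.map q).dartsOn W).image l ∪
      ({(x, u), (u, x), (x, v), (v, x)} : Finset (V × V)) ⊆
      G.dartsOn (insert x (insert v W)) := by
    refine union_subset (fun p hp => ?_) fun p hp => ?_
    · obtain ⟨h1, h2, h3⟩ := hIprop p hp
      exact mem_dartsOn.2 ⟨⟨mem_insert_of_mem (hpre _ h2).1, mem_insert_of_mem (hpre _ h3).1⟩, h1⟩
    · simp only [mem_insert, mem_singleton] at hp
      rcases hp with rfl | rfl | rfl | rfl <;> simp [huW, hxu, hxv, hxu.symm, hxv.symm]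
  have hcards := card_le_card hsub
  have h4 : #({(x, u), (u, x), (x, v), (v, x)} : Finset (V × V)) = 4 := by
    have h1 := hxu.ne
    have h2 := hxv.ne
    repeat rw [card_insert_of_notMem]
    · simp
    all_goals simp [h1, h2, h1.symm, h2.symm, huv]
  rw [card_union_of_disjoint hdisj, hlcard, h4] at hcards
  unfold potential at hpot hW
  rw [hcard] at hpot
  push_cast at hpot
  omega

/-- In a counterexample, a vertex of degree three has at most one neighbor of degree three. -/
lemma two_le_card_neighbors_of_degree_three (hS : G.IsPotentialCounterexample S) {x : V}
    (hx : x ∈ S) (hdx : #(G.neighborsOn S x) = 3) :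
    2 ≤ #((G.neighborsOn S x).filter fun w => ¬ #(G.neighborsOn S w) = 3) := by
  classical
  refine le_of_not_gt fun h => ?_
  have h1 := card_filter_add_card_filter_not (s := G.neighborsOn S x)
    fun w => #(G.neighborsOn S w) = 3
  obtain ⟨y, hy, z, hz, hyz⟩ := one_lt_card.1
    (by omega : 1 < #((G.neighborsOn S x).filter fun w => #(G.neighborsOn S w) = 3))
  simp only [mem_filter, mem_neighborsOn] at hy hz
  have hsub : ({y, z} : Finset V) ⊆ G.neighborsOn S x := by
    intro w hw
    rw [mem_insert, mem_singleton] at hw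
    rcases hw with rfl | rfl
    · simp [hy.1.1, hy.1.2]
    · simp [hz.1.1, hz.1.2]
  have h2 : #(G.neighborsOn S x \ {y, z}) = 1 := by
    rw [card_sdiff_of_subset hsub, hdx, card_pair hyz]
  obtain ⟨v, hv⟩ := card_eq_one.1 h2
  have hv' : v ∈ G.neighborsOn S x \ {y, z} := by simp [hv]
  simp only [mem_sdiff, mem_insert, mem_singleton, not_or, mem_neighborsOn] at hv'
  have hNx : ∀ w, w ∈ S ∧ G.Adj x w ↔ w = y ∨ w = z ∨ w = v := by
    intro w
    rw [← mem_neighborsOn, ← sdiff_union_of_subset hsub, hv]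
    simp
    tauto
  have hzv := hS.adj_of_degree_three hx hy.1.1 hy.2 hNx hyz (Ne.symm hv'.2.1) (Ne.symm hv'.2.2)
  exact hS.not_triangle hx hz.1.1 hv'.1.1 hdx hz.2 hz.1.2 hv'.1.2 hzv

theorem false (hS : G.IsPotentialCounterexample S) : False := by
  classical
  set d : V → ℕ := fun v => #(G.neighborsOn S v) with hd
  set A := S.filter fun v => d v = 3 with hA
  set B := S.filter fun v => ¬ d v = 3 with hB
  have hAB : #A + #B = #S := card_filter_add_card_filter_not _
  have hsum : ∑ v ∈ A, d v + ∑ v ∈ B, d v = #(G.dartsOn S) := by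
    rw [card_dartsOn_eq_sum]
    exact sum_filter_add_sum_filter_not _ _ _
  have hAsum : ∑ v ∈ A, d v = #A * 3 := by
    rw [sum_congr rfl fun v hv => (mem_filter.1 hv).2, sum_const, smul_eq_mul]
  have hB4 : #B * 4 ≤ ∑ v ∈ B, d v := by
    rw [← smul_eq_mul]
    refine card_nsmul_le_sum _ _ _ fun v hv => ?_
    have h1 := hS.three_le_card_neighborsOn (mem_filter.1 hv).1
    have h2 := (mem_filter.1 hv).2
    simp only [hd] at h2 ⊢
    omega
  have hA2 : #A * 2 ≤ ∑ v ∈ B, d v := by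
    calc #A * 2 ≤ ∑ a ∈ A, #(B.filter fun b => G.Adj a b) := by
          rw [← smul_eq_mul]
          refine card_nsmul_le_sum _ _ _ fun v hv => ?_
          rw [hA, mem_filter] at hv
          refine (hS.two_le_card_neighbors_of_degree_three hv.1 hv.2).trans
            (card_le_card fun w hw => ?_)
          simp only [mem_filter, mem_neighborsOn, hB] at hw ⊢
          exact ⟨⟨hw.1.1, hw.2⟩, hw.1.2⟩
      _ = ∑ b ∈ B, #(A.filter fun a => G.Adj a b) :=
          sum_card_bipartiteAbove_eq_sum_card_bipartiteBelow _
      _ ≤ ∑ b ∈ B, d b := by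
          refine sum_le_sum fun b _ => card_le_card fun a ha => ?_
          simp only [mem_filter, hA, mem_neighborsOn] at ha ⊢
          exact ⟨ha.1.1, ha.2.symm⟩
  have hgt := hS.potential_gt
  unfold potential at hgt
  omega

end IsPotentialCounterexample

/-- The Kostochka–Yancey bound: a graph which is not 3-colorable contains a subgraph which is not
3-colorable and satisfies `3 |E| ≥ 5 |V| - 2`. -/
theorem exists_potential_le (n : ℕ) : ∀ (G : SimpleGraph V) (S : Finset V), #S = n →
    ¬ G.ThreeColorableOn S → ∃ W ⊆ S, ¬ G.ThreeColorableOn W ∧ G.potential W ≤ 4 := by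
  induction n using Nat.strong_induction_on with
  | _ n ih =>
    intro G S hn hcol
    by_cases hcrit : ∀ R ⊂ S, G.ThreeColorableOn R
    · by_contra! hcon
      exact IsPotentialCounterexample.false (G := G) (S := S)
        ⟨hcol, hcrit, hcon S Subset.rfl hcol, fun G' S' h => ih _ (hn ▸ h) G' S' rfl⟩
    · push Not at hcrit
      obtain ⟨R, hR, hRcol⟩ := hcrit
      obtain ⟨W, hW, h⟩ := ih _ (hn ▸ card_lt_card hR) G R rfl hRcol
      exact ⟨W, hW.trans hR.1, h⟩

end SimpleGraph

section Sparse

open Submodule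

variable {ι E E' : Type*}

/-- A family of vectors over `ZMod 2` is sparse if at most two of its members are nonzero at each
coordinate. -/
def IsSparse (b : ι → E → ZMod 2) : Prop :=
  ∀ e i j k, b i e ≠ 0 → b j e ≠ 0 → b k e ≠ 0 → i = j ∨ j = k ∨ i = k

/-- The subspace of vectors vanishing on `S`. -/
def vanishOn (S : Set E) : Submodule (ZMod 2) (E → ZMod 2) where
  carrier := {c | ∀ e ∈ S, c e = 0}
  add_mem' ha hb e he := by simp [ha e he, hb e he]
  zero_mem' e _ := rfl
  smul_mem' r c hc e he := by simp [hc e he]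

@[simp]
lemma mem_vanishOn {S : Set E} {c : E → ZMod 2} : c ∈ vanishOn S ↔ ∀ e ∈ S, c e = 0 := Iff.rfl

lemma ZMod.eq_one_of_ne_zero_two {a : ZMod 2} (h : a ≠ 0) : a = 1 := by
  revert a; decide

/-- Forcing coordinates to vanish preserves the existence of sparse spanning families. -/
theorem IsSparse.exists_vanishOn [Finite ι] (S : Set E) {b : ι → E → ZMod 2} (hb : IsSparse b) :
    ∃ b' : ι → E → ZMod 2, IsSparse b' ∧
      span (ZMod 2) (Set.range b') = span (ZMod 2) (Set.range b) ⊓ vanishOn S ∧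
      ∀ i, b i ∈ vanishOn S → b' i = b i := by
  induction hn : {i | b i ≠ 0}.ncard using Nat.strong_induction_on generalizing b with
  | _ n ih =>
    by_cases hall : ∀ i, b i ∈ vanishOn S
    · refine ⟨b, hb, ?_, fun _ _ => rfl⟩
      rw [eq_comm, inf_eq_left, span_le]
      rintro _ ⟨i, rfl⟩
      exact hall i
    push Not at hall
    obtain ⟨i₀, hi₀⟩ := hall
    simp only [mem_vanishOn, not_forall] at hi₀
    obtain ⟨e, heS, he⟩ := hi₀
    set T : (E → ZMod 2) →ₗ[ZMod 2] (E → ZMod 2) :=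
      LinearMap.id + (LinearMap.proj e).smulRight (b i₀) with hT
    have hTa : ∀ c, T c = c + c e • b i₀ := fun c => by simp [hT]
    have hT0 : ∀ c, c e = 0 → T c = c := fun c hc => by simp [hTa, hc]
    have hTi₀ : T (b i₀) = 0 := by
      rw [hTa, ZMod.eq_one_of_ne_zero_two he, one_smul]
      exact funext fun f => CharTwo.add_self_eq_zero _
    have hTf : ∀ i f, T (b i) f ≠ 0 → i ≠ i₀ ∧ (b i f ≠ 0 ∨ b i e ≠ 0 ∧ b i₀ f ≠ 0) := by
      intro i f h
      refine ⟨fun hi => h (by rw [hi, hTi₀]; rfl), ?_⟩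
      by_contra! hcon
      refine h ?_
      rw [hTa]
      by_cases h1 : b i e = 0
      · simp [h1, hcon.1]
      · simp [hcon.1, hcon.2 h1]
    have hsp : IsSparse fun i => T (b i) := by
      intro f i j k hi hj hk
      obtain ⟨hi0, hi⟩ := hTf i f hi
      obtain ⟨hj0, hj⟩ := hTf j f hj
      obtain ⟨hk0, hk⟩ := hTf k f hk
      have h1 := hb f i j k
      have h2 := hb f i₀ j k
      have h3 := hb f i₀ i k
      have h4 := hb f i₀ i j
      have h5 := hb e i₀ i j he
      have h6 := hb e i₀ i k he
      have h7 := hb e i₀ j k he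
      grind
    obtain ⟨b', hb', hspan, hfix⟩ := ih _ (by
      rw [← hn]
      refine Set.ncard_lt_ncard (Set.ssubset_iff_of_subset ?_ |>.2 ⟨i₀, ?_, ?_⟩) (Set.toFinite _)
      · intro i hi hbi
        exact hi (by simp [hbi])
      · intro h
        exact he (by rw [h]; rfl)
      · simp [hTi₀]) hsp rfl
    refine ⟨b', hb', ?_, fun i hi => ?_⟩
    · rw [hspan, Set.range_comp' T b, ← map_span]
      have hle : ∀ c ∈ span (ZMod 2) (Set.range b), T c ∈ span (ZMod 2) (Set.range b) := by
        intro c hc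
        rw [hTa]
        exact add_mem hc (smul_mem _ _ (subset_span ⟨i₀, rfl⟩))
      ext c
      simp only [mem_inf, mem_map]
      constructor
      · rintro ⟨⟨c, hc, rfl⟩, h⟩
        exact ⟨hle c hc, h⟩
      · rintro ⟨hc, h⟩
        exact ⟨⟨c, hc, hT0 c (h e heS)⟩, h⟩
    · have h := hT0 _ (hi e heS)
      rw [hfix i (by rwa [h]), h]

/-- Reindexing coordinates preserves sparsity. -/
lemma IsSparse.comp_right {b : ι → E → ZMod 2} (hb : IsSparse b) (h : E' → E) :
    IsSparse fun i => b i ∘ h :=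
  fun e => hb (h e)

lemma IsSparse.comp_injective {κ : Type*} {b : ι → E → ZMod 2} (hb : IsSparse b) {a : κ → ι}
    (ha : Function.Injective a) : IsSparse (b ∘ a) := fun e i j k hi hj hk => by
  have := hb e (a i) (a j) (a k) hi hj hk
  simpa only [ha.eq_iff] using this

lemma span_range_comp_right (b : ι → E → ZMod 2) (h : E' → E) :
    span (ZMod 2) (Set.range fun i => b i ∘ h) =
      (span (ZMod 2) (Set.range b)).map (LinearMap.funLeft (ZMod 2) (ZMod 2) h) := by
  rw [map_span, ← Set.range_comp]
  rfl

end Sparse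

namespace SimpleGraph

open Finset Submodule

/-- The boundary map from edge vectors to vertex vectors over `ZMod 2`. -/
def boundaryTwo [Fintype V] : (Sym2 V → ZMod 2) →ₗ[ZMod 2] (V → ZMod 2) where
  toFun c v := ∑ w, c s(v, w)
  map_add' c d := by ext v; simp [sum_add_distrib]
  map_smul' r c := by ext v; simp [mul_sum]

lemma boundaryTwo_apply [Fintype V] (c : Sym2 V → ZMod 2) (v : V) :
    boundaryTwo c v = ∑ w, c s(v, w) := rfl

/-- The cycle space of a graph over `ZMod 2`. -/
def cycleSpace [Fintype V] (G : SimpleGraph V) : Submodule (ZMod 2) (Sym2 V → ZMod 2) :=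
  vanishOn G.edgeSetᶜ ⊓ LinearMap.ker boundaryTwo

/-- MacLane's planarity condition: the cycle space has a sparse spanning family. -/
def IsMacLane [Fintype V] (G : SimpleGraph V) : Prop :=
  ∃ (ι : Type) (_ : Finite ι) (b : ι → Sym2 V → ZMod 2), IsSparse b ∧
    span (ZMod 2) (Set.range b) = G.cycleSpace

variable [Fintype V] {G H : SimpleGraph V}

lemma mem_cycleSpace {c : Sym2 V → ZMod 2} :
    c ∈ G.cycleSpace ↔ (∀ e, e ∉ G.edgeSet → c e = 0) ∧ ∀ v, ∑ w, c s(v, w) = 0 := by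
  simp [cycleSpace, funext_iff, boundaryTwo_apply]

lemma cycleSpace_mono (h : H ≤ G) : H.cycleSpace = G.cycleSpace ⊓ vanishOn H.edgeSetᶜ := by
  ext c
  simp only [Submodule.mem_inf, mem_cycleSpace, mem_vanishOn, Set.mem_compl_iff]
  refine ⟨fun hc => ⟨⟨fun e he => hc.1 e fun h' => he (edgeSet_mono h h'), hc.2⟩, hc.1⟩,
    fun hc => ⟨hc.2, hc.1.2⟩⟩

lemma IsMacLane.mono (hG : G.IsMacLane) (h : H ≤ G) : H.IsMacLane := by
  obtain ⟨ι, _, b, hb, hspan⟩ := hG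
  obtain ⟨b', hb', hspan', -⟩ := hb.exists_vanishOn H.edgeSetᶜ
  exact ⟨ι, inferInstance, b', hb', by rw [hspan', hspan, cycleSpace_mono h]⟩

lemma boundaryTwo_single [DecidableEq V] {a b : V} (hab : a ≠ b) :
    boundaryTwo (Pi.single s(a, b) 1) = Pi.single a 1 + Pi.single b 1 := by
  ext v
  rw [boundaryTwo_apply]
  by_cases hva : v = a
  · subst hva
    rw [sum_eq_single b]
    · simp [hab]
    · intro w _ hw
      simp [hw, hab]
    · simp
  · by_cases hvb : v = b
    · subst hvb
      rw [sum_eq_single a]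
      · simp [hab.symm, Sym2.eq_swap (a := a)]
      · intro w _ hw
        simp [hw, hva]
      · simp
    · simp [hva, hvb]

end SimpleGraph

section Sparse

open Submodule Finset

variable {ι E : Type*}

/-- A sparse spanning family can be chosen to consist of a basis together with its sum. -/
lemma IsSparse.option_sum [Fintype ι] {b : ι → E → ZMod 2} (hb : IsSparse b) :
    IsSparse fun o : Option ι => o.elim (∑ i, b i) b := by
  classical
  have key : ∀ e i j, i ≠ j → b i e ≠ 0 → b j e ≠ 0 → (∑ i, b i) e = 0 := by
    intro e i j hij hi hj
    rw [Finset.sum_apply, ← sum_subset (subset_univ {i, j})]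
    · rw [sum_pair hij, ZMod.eq_one_of_ne_zero_two hi, ZMod.eq_one_of_ne_zero_two hj]
      rfl
    · intro k _ hk
      simp only [mem_insert, mem_singleton, not_or] at hk
      by_contra h
      have := hb e i j k hi hj h
      tauto
  intro e i j k hi hj hk
  rcases i with _ | i <;> rcases j with _ | j <;> rcases k with _ | k <;> simp at hi hj hk ⊢
  · by_contra h
    exact hi (by simpa using key e j k h hj hk)
  · by_contra h
    exact hj (by simpa using key e i k h hi hk)
  · by_contra h
    exact hk (by simpa using key e i j h hi hj)
  · exact hb e i j k hi hj hk

lemma IsSparse.sum_card_le [Fintype ι] [Fintype E] {b : ι → E → ZMod 2} (hb : IsSparse b)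
    {A : Finset E} (hA : ∀ i e, b i e ≠ 0 → e ∈ A) {k : ℕ}
    (hk : ∀ i, k ≤ #(univ.filter fun e => b i e ≠ 0)) : k * Fintype.card ι ≤ 2 * #A := by
  classical
  calc k * Fintype.card ι ≤ ∑ i, #(A.filter fun e => b i e ≠ 0) := by
        rw [mul_comm, ← smul_eq_mul, ← card_univ]
        refine card_nsmul_le_sum _ _ _ fun i _ => (hk i).trans (card_le_card fun e he => ?_)
        simp only [mem_filter, mem_univ, true_and] at he ⊢
        exact ⟨hA i e he, he⟩
    _ = ∑ e ∈ A, #(univ.filter fun i => b i e ≠ 0) :=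
        sum_card_bipartiteAbove_eq_sum_card_bipartiteBelow _
    _ ≤ 2 * #A := by
        rw [mul_comm, ← smul_eq_mul]
        refine sum_le_card_nsmul _ _ _ fun e _ => ?_
        by_contra! h
        obtain ⟨i, hi, j, hj, k, hk, hij, hik, hjk⟩ := two_lt_card.1 h
        simp only [mem_filter, mem_univ, true_and] at hi hj hk
        have := hb e i j k hi hj hk
        tauto

end Sparse

namespace SimpleGraph

open Finset Submodule

variable [Fintype V] {G : SimpleGraph V}

lemma sum_boundaryTwo {c : Sym2 V → ZMod 2} (hc : ∀ v, c s(v, v) = 0) :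
    ∑ v, boundaryTwo c v = 0 := by
  simp only [boundaryTwo_apply]
  rw [← Fintype.sum_prod_type' (f := fun v w => c s(v, w))]
  refine sum_involution (fun p _ => p.swap) ?_ ?_ ?_ ?_
  · rintro ⟨v, w⟩ _
    rw [Sym2.eq_swap]
    exact CharTwo.add_self_eq_zero _
  · rintro ⟨v, w⟩ _ h h'
    simp only [Prod.swap_prod_mk, Prod.mk.injEq] at h'
    exact h (by rw [h'.1]; exact hc v)
  · simp
  · simp

lemma card_edgeFinset_lt_finrank [DecidableEq V] [Fintype G.edgeSet] {R : Finset V}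
    (hR : R.Nonempty) (hGR : ∀ v w, G.Adj v w → v ∈ R) :
    #G.edgeFinset < Module.finrank (ZMod 2) G.cycleSpace + #R := by
  classical
  obtain ⟨r, hr⟩ := hR
  let Φ : (Sym2 V → ZMod 2) →ₗ[ZMod 2]
      ({e // e ∈ G.edgeFinsetᶜ} → ZMod 2) × ({v // v ∈ R.erase r} → ZMod 2) :=
    (LinearMap.funLeft _ _ Subtype.val).prod (LinearMap.funLeft _ _ Subtype.val ∘ₗ boundaryTwo)
  have hker : LinearMap.ker Φ ≤ G.cycleSpace := by
    intro c hc
    have hc := Prod.ext_iff.1 (LinearMap.mem_ker.1 hc)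
    have h1 : ∀ e, e ∉ G.edgeSet → c e = 0 := fun e he =>
      congr_fun hc.1 ⟨e, by simpa using he⟩
    have h2 : ∀ v, v ≠ r → boundaryTwo c v = 0 := by
      intro v hv
      by_cases hvR : v ∈ R
      · exact congr_fun hc.2 ⟨v, mem_erase.2 ⟨hv, hvR⟩⟩
      · rw [boundaryTwo_apply]
        exact sum_eq_zero fun w _ => h1 _ fun h => hvR (hGR _ _ h)
    refine mem_cycleSpace.2 ⟨h1, fun v => ?_⟩
    by_cases hv : v = r
    · have h3 := sum_boundaryTwo (c := c) fun v => h1 _ (by simp)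
      rw [sum_eq_single r (fun w _ h => h2 w h) (by simp)] at h3
      rw [hv]
      exact h3
    · exact h2 v hv
  have h1 := LinearMap.finrank_range_add_finrank_ker Φ
  have h2 := Submodule.finrank_mono hker
  have h3 := Submodule.finrank_le (LinearMap.range Φ)
  rw [Module.finrank_prod, Module.finrank_fintype_fun_eq_card, Module.finrank_fintype_fun_eq_card,
    Fintype.card_coe, Fintype.card_coe, card_compl, card_erase_of_mem hr] at h3
  rw [Module.finrank_fintype_fun_eq_card] at h1
  have h4 : #G.edgeFinset ≤ Fintype.card (Sym2 V) := card_le_univ _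
  have h5 : 0 < #R := card_pos.2 ⟨r, hr⟩
  omega

/-- Euler's formula: a graph satisfying MacLane's condition with many edges has a sparse spanning
family containing a short nonzero member. -/
lemma IsMacLane.exists_short (hG : G.IsMacLane) [DecidableEq V] [Fintype G.edgeSet] {R : Finset V}
    (hR : R.Nonempty) (hGR : ∀ v w, G.Adj v w → v ∈ R) (hcard : 5 * #R ≤ 3 * #G.edgeFinset + 2) :
    ∃ (ι : Type) (_ : Finite ι) (b : ι → Sym2 V → ZMod 2), IsSparse b ∧
      span (ZMod 2) (Set.range b) = G.cycleSpace ∧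
      ∃ i, b i ≠ 0 ∧ #(univ.filter fun e => b i e ≠ 0) ≤ 4 := by
  obtain ⟨ι, _, b, hb, hspan⟩ := hG
  obtain ⟨κ, a, ha, hab, hlin⟩ := exists_linearIndependent' (ZMod 2) b
  have : Finite κ := Finite.of_injective a ha
  have := Fintype.ofFinite κ
  have hd := finrank_span_eq_card hlin
  rw [hab, hspan] at hd
  have hlt := card_edgeFinset_lt_finrank hR hGR
  have hspan' : span (ZMod 2)
      (Set.range fun o : Option κ => o.elim (∑ i, (b ∘ a) i) (b ∘ a)) = G.cycleSpace := by
    rw [← hspan, ← hab]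
    refine le_antisymm (span_le.2 ?_) (span_mono ?_)
    · rintro _ ⟨_ | i, rfl⟩
      · exact sum_mem fun i _ => subset_span ⟨i, rfl⟩
      · exact subset_span ⟨i, rfl⟩
    · rintro _ ⟨i, rfl⟩
      exact ⟨some i, rfl⟩
  have hsp := (hb.comp_injective ha).option_sum
  refine ⟨Option κ, inferInstance, _, hsp, hspan', ?_⟩
  by_contra! hcon
  rcases isEmpty_or_nonempty κ with hκ | ⟨⟨i₀⟩⟩
  · rw [Fintype.card_eq_zero] at hd
    omega
  · have hne : ∀ o : Option κ, o.elim (∑ i, (b ∘ a) i) (b ∘ a) ≠ 0 := by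
      rintro (_ | i)
      · intro h
        exact one_ne_zero (Fintype.linearIndependent_iff.1 hlin (fun _ => 1) (by simpa using h) i₀)
      · exact hlin.ne_zero i
    have h5 := hsp.sum_card_le (A := G.edgeFinset) (k := 5) (fun i e h => by
      by_contra he
      have hmem : (fun o : Option κ => o.elim (∑ i, (b ∘ a) i) (b ∘ a)) i ∈ G.cycleSpace := by
        rw [← hspan']
        exact subset_span ⟨i, rfl⟩
      exact h ((mem_cycleSpace.1 hmem).1 e (by simpa using he))) fun o => hcon o (hne o)
    rw [Fintype.card_option] at h5
    omega

/-- A short nonzero vector in the cycle space of a triangle-free graph is a cycle of length four. -/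
lemma exists_four_cycle [DecidableEq V] (hG : G.CliqueFree 3) {c : Sym2 V → ZMod 2}
    (hc : c ∈ G.cycleSpace) (hc0 : c ≠ 0) (hcard : #(univ.filter fun e => c e ≠ 0) ≤ 4) :
    ∃ x y z u, G.Adj x y ∧ G.Adj y z ∧ G.Adj z u ∧ G.Adj u x ∧ x ≠ z ∧ y ≠ u ∧
      ∀ e, c e ≠ 0 ↔ e = s(x, y) ∨ e = s(y, z) ∨ e = s(z, u) ∨ e = s(u, x) := by
  obtain ⟨hsupp, hcyc⟩ := mem_cycleSpace.1 hc
  have hadj : ∀ {a b}, c s(a, b) ≠ 0 → G.Adj a b := fun h => by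
    by_contra h'
    exact h (hsupp _ h')
  have htri : ∀ {a b d}, G.Adj a b → G.Adj b d → G.Adj d a → False := fun h1 h2 h3 =>
    hG {_, _, _} (is3Clique_triple_iff.2 ⟨h1, h3.symm, h2⟩)
  have hnext : ∀ {a b}, c s(a, b) ≠ 0 → ∃ d, d ≠ a ∧ c s(b, d) ≠ 0 := by
    intro a b h
    by_contra! hcon
    refine h ?_
    rw [Sym2.eq_swap, ← hcyc b]
    exact (sum_eq_single a (fun d _ hd => hcon d hd) (by simp)).symm
  have hle : ∀ s : Finset (Sym2 V), (∀ e ∈ s, c e ≠ 0) → 4 ≤ #s → ∀ e, c e ≠ 0 → e ∈ s := by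
    intro s hs h4 e he
    have h1 : s ⊆ univ.filter fun e => c e ≠ 0 := fun e he => by simpa using hs e he
    rw [eq_of_subset_of_card_le h1 (hcard.trans h4)]
    simpa using he
  obtain ⟨e, he⟩ := Function.ne_iff.1 hc0
  induction e with
  | _ x y =>
    have hxy : c s(x, y) ≠ 0 := he
    obtain ⟨z, hzx, hyz⟩ := hnext hxy
    obtain ⟨u, huy, hzu⟩ := hnext hyz
    obtain ⟨w, hwz, huw⟩ := hnext hzu
    have a1 := hadj hxy
    have a2 := hadj hyz
    have a3 := hadj hzu
    have a4 := hadj huw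
    have n1 := a1.ne
    have n2 := a2.ne
    have n3 := a3.ne
    have n4 := a4.ne
    have n5 : u ≠ x := fun h => htri a1 a2 (h ▸ a3)
    have n6 : w ≠ y := fun h => htri a2 a3 (h ▸ a4)
    have hwx : w = x := by
      by_contra hwx
      obtain ⟨w', hw'y, hxw'⟩ := hnext (a := y) (b := x) (by rwa [Sym2.eq_swap])
      have h4 : #({s(x, y), s(y, z), s(z, u), s(u, w)} : Finset (Sym2 V)) = 4 := by
        repeat rw [card_insert_of_notMem]
        · simp
        all_goals simp; grind
      have := hle _ (by simp [hxy, hyz, hzu, huw]) h4.ge _ hxw'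
      simp at this
      grind
    subst hwx
    have h4 : #({s(w, y), s(y, z), s(z, u), s(u, w)} : Finset (Sym2 V)) = 4 := by
      repeat rw [card_insert_of_notMem]
      · simp
      all_goals simp; grind
    refine ⟨w, y, z, u, a1, a2, a3, a4, hwz, huy.symm, fun e => ⟨fun he => ?_, ?_⟩⟩
    · simpa using hle _ (by simp [hxy, hyz, hzu, huw]) h4.ge _ he
    · rintro (rfl | rfl | rfl | rfl) <;> assumption

/-- If `h` chooses a preimage for every edge of `G.map q` and `c` is supported on the chosen
edges, then `c ∘ h` is the pushforward of `c` along `q`. -/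
lemma apply_choice_eq_sum [DecidableEq V] {q : V → V} {h : Sym2 V → Sym2 V}
    (hq : ∀ e ∈ (G.map q).edgeSet, (h e).map q = e)
    (hd : ∀ e ∉ (G.map q).edgeSet, (h e).IsDiag) {c : Sym2 V → ZMod 2}
    (hc : ∀ e, c e ≠ 0 → e ∈ G.edgeSet ∧ ∃ f ∈ (G.map q).edgeSet, h f = e) (v w : V) :
    c (h s(v, w)) = ∑ a, ∑ b, if q a = v ∧ q b = w then c s(a, b) else 0 := by
  have hc' : ∀ a b, c s(a, b) ≠ 0 → s(q a, q b) ∈ (G.map q).edgeSet ∧ h s(q a, q b) = s(a, b) := by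
    intro a b hab
    obtain ⟨-, f, hf, hfe⟩ := hc _ hab
    have := hq f hf
    rw [hfe, Sym2.map_mk] at this
    exact ⟨this ▸ hf, this ▸ hfe⟩
  by_cases hvw : s(v, w) ∈ (G.map q).edgeSet
  · have hne : v ≠ w := ((map_adj' _ _ _ _).1 hvw).1
    obtain ⟨a, b, ha, hb, hab⟩ : ∃ a b, q a = v ∧ q b = w ∧ h s(v, w) = s(a, b) := by
      have := hq _ hvw
      generalize h s(v, w) = e at this
      induction e with
      | _ a b =>
        rw [Sym2.map_mk, Sym2.eq_iff] at this
        rcases this with ⟨h1, h2⟩ | ⟨h1, h2⟩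
        · exact ⟨a, b, h1, h2, rfl⟩
        · exact ⟨b, a, h2, h1, Sym2.eq_swap⟩
    have key : ∀ a' b', q a' = v → q b' = w → c s(a', b') ≠ 0 → a' = a ∧ b' = b := by
      intro a' b' ha' hb' h0
      have h1 := (hc' _ _ h0).2
      rw [ha', hb', hab, Sym2.eq_iff] at h1
      rcases h1 with ⟨rfl, rfl⟩ | ⟨rfl, rfl⟩
      · exact ⟨rfl, rfl⟩
      · exact absurd (ha.symm.trans hb') hne
    rw [sum_eq_single a, sum_eq_single b]
    · simp [ha, hb, hab]
    · intro b' _ hb'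
      by_contra h0
      have h1 : q a = v ∧ q b' = w := by by_contra h1; simp [h1] at h0
      rw [if_pos h1] at h0
      exact hb' (key _ _ h1.1 h1.2 h0).2
    · simp
    · intro a' _ ha'
      refine sum_eq_zero fun b' _ => ?_
      by_contra h0
      have h1 : q a' = v ∧ q b' = w := by by_contra h1; simp [h1] at h0
      rw [if_pos h1] at h0
      exact ha' (key _ _ h1.1 h1.2 h0).1
    · simp
  · rw [sum_eq_zero]
    · by_contra h0
      obtain ⟨h1, -⟩ := hc _ h0
      exact G.not_isDiag_of_mem_edgeSet h1 (hd _ hvw)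
    · intro a _
      refine sum_eq_zero fun b _ => ?_
      by_contra h0
      have h1 : q a = v ∧ q b = w := by by_contra h1; simp [h1] at h0
      rw [if_pos h1] at h0
      have := (hc' _ _ h0).1
      rw [h1.1, h1.2] at this
      exact hvw this

/-- MacLane's condition for an image of `G` under identification of vertices follows from a
sparse spanning family of the space of vectors whose boundary vanishes after identification. -/
lemma isMacLane_map_of_sparse [DecidableEq V] {q : V → V} {ι : Type} [Finite ι]
    {b : ι → Sym2 V → ZMod 2} (hb : IsSparse b)
    (hspan : ∀ c, c ∈ span (ZMod 2) (Set.range b) ↔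
      (∀ e, e ∉ G.edgeSet → c e = 0) ∧ ∀ v, ∑ a, (if q a = v then boundaryTwo c a else 0) = 0) :
    (G.map q).IsMacLane := by
  have hex : ∀ e, ∃ f, (e ∈ (G.map q).edgeSet → f ∈ G.edgeSet ∧ f.map q = e) ∧
      (e ∉ (G.map q).edgeSet → f.IsDiag) := by
    intro e
    induction e with
    | _ v w =>
      by_cases he : s(v, w) ∈ (G.map q).edgeSet
      · obtain ⟨-, a, b, hab, rfl, rfl⟩ := (map_adj' _ _ _ _).1 he
        exact ⟨s(a, b), fun _ => ⟨hab, rfl⟩, fun h => absurd he h⟩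
      · exact ⟨s(v, v), fun h => absurd h he, fun _ => by simp⟩
  choose h hG hd using hex
  have hq : ∀ e ∈ (G.map q).edgeSet, (h e).map q = e := fun e he => (hG e he).2
  obtain ⟨b', hb', hspan', -⟩ := hb.exists_vanishOn (h '' (G.map q).edgeSet)ᶜ
  refine ⟨ι, inferInstance, _, hb'.comp_right h, ?_⟩
  rw [span_range_comp_right, hspan']
  have hsum : ∀ c : Sym2 V → ZMod 2,
      (∀ e, c e ≠ 0 → e ∈ G.edgeSet ∧ ∃ f ∈ (G.map q).edgeSet, h f = e) → ∀ v,
      ∑ w, c (h s(v, w)) = ∑ a, if q a = v then boundaryTwo c a else 0 := by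
    intro c hc v
    simp_rw [apply_choice_eq_sum hq hd hc]
    rw [sum_comm]
    refine sum_congr rfl fun a _ => ?_
    rw [sum_comm, boundaryTwo_apply]
    by_cases ha : q a = v
    · simp [ha]
    · simp [ha]
  ext z
  simp only [Submodule.mem_map, Submodule.mem_inf, mem_vanishOn, hspan, mem_cycleSpace]
  constructor
  · rintro ⟨c, ⟨⟨hc1, hc2⟩, hc3⟩, rfl⟩
    refine ⟨fun e he => hc1 _ fun h' => G.not_isDiag_of_mem_edgeSet h' (hd e he), fun v => ?_⟩
    rw [← hc2 v, ← hsum c (fun e he => ⟨?_, ?_⟩) v]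
    · rfl
    · by_contra h1
      exact he (hc1 e h1)
    · by_contra h1
      exact he (hc3 e (by simpa using h1))
  · rintro ⟨hz1, hz2⟩
    classical
    let c : Sym2 V → ZMod 2 := fun f => if f ∈ h '' (G.map q).edgeSet then z (f.map q) else 0
    have hcz : c ∘ h = z := by
      ext e
      by_cases he : e ∈ (G.map q).edgeSet
      · simp only [c, Function.comp_apply, if_pos (Set.mem_image_of_mem h he), hq e he]
      · rw [hz1 e he, Function.comp_apply]
        refine if_neg ?_
        rintro ⟨f, hf, hfe⟩
        exact G.not_isDiag_of_mem_edgeSet (hG f hf).1 (hfe ▸ hd e he)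
    have hc0 : ∀ e, c e ≠ 0 → e ∈ h '' (G.map q).edgeSet := fun e he => by
      by_contra h1
      exact he (if_neg h1)
    have hcG : ∀ e, c e ≠ 0 → e ∈ G.edgeSet := fun e he => by
      obtain ⟨f, hf, rfl⟩ := hc0 e he
      exact (hG f hf).1
    refine ⟨c, ⟨⟨fun e he => ?_, fun v => ?_⟩, fun e he => ?_⟩, hcz⟩
    · by_contra h1
      exact he (hcG e h1)
    · rw [← hsum c (fun e he => ⟨hcG e he, hc0 e he⟩) v, ← hz2 v, ← hcz]
      rfl
    · by_contra h1
      exact he (hc0 e h1)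

/-- The indicator vector of a closed walk of length four. -/
def fourCycle [DecidableEq V] (x y z u : V) : Sym2 V → ZMod 2 :=
  Pi.single s(x, y) 1 + Pi.single s(y, z) 1 + (Pi.single s(z, u) 1 + Pi.single s(u, x) 1)

/-- Identifying opposite vertices of a face of length four preserves MacLane's condition. -/
lemma isMacLane_map_of_fourCycle [DecidableEq V] {ι : Type} [Finite ι] {b : ι → Sym2 V → ZMod 2}
    (hb : IsSparse b) (hspan : span (ZMod 2) (Set.range b) = G.cycleSpace) {x y z u : V}
    (hxy : G.Adj x y) (hyz : G.Adj y z) (hzu : G.Adj z u) (hux : G.Adj u x)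
    (hxz : x ≠ z) (hyu : y ≠ u) {i₀ : ι} (hF : b i₀ = fourCycle x y z u) :
    (G.map fun w => if w = z then x else w).IsMacLane := by
  classical
  have := Fintype.ofFinite ι
  set P : Sym2 V → ZMod 2 := Pi.single s(x, y) 1 + Pi.single s(y, z) 1 with hP
  set Q : Sym2 V → ZMod 2 := Pi.single s(z, u) 1 + Pi.single s(u, x) 1 with hQ
  have hFPQ : b i₀ = P + Q := hF
  have n1 := hxy.ne
  have n2 := hyz.ne
  have n3 := hzu.ne
  have n4 := hux.ne
  have hP' : ∀ e, P e ≠ 0 → e = s(x, y) ∨ e = s(y, z) := by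
    intro e he
    by_contra! h
    exact he (by simp [hP, h.1, h.2])
  have hQ' : ∀ e, Q e ≠ 0 → e = s(z, u) ∨ e = s(u, x) := by
    intro e he
    by_contra! h
    exact he (by simp [hQ, h.1, h.2])
  have hPQ : ∀ e, P e ≠ 0 → Q e ≠ 0 → False := by
    intro e h1 h2
    rcases hP' e h1 with rfl | rfl <;> rcases hQ' _ h2 with h | h <;> simp at h <;> grind
  have hPF : ∀ e, P e ≠ 0 → b i₀ e ≠ 0 := by
    intro e h1 h2
    have h3 : Q e = 0 := by
      by_contra h3
      exact hPQ e h1 h3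
    rw [hFPQ, Pi.add_apply, h3, add_zero] at h2
    exact h1 h2
  have hQF : ∀ e, Q e ≠ 0 → b i₀ e ≠ 0 := by
    intro e h1 h2
    have h3 : P e = 0 := by
      by_contra h3
      exact hPQ e h3 h1
    rw [hFPQ, Pi.add_apply, h3, zero_add] at h2
    exact h1 h2
  let b₁ : Option ι → Sym2 V → ZMod 2 := fun o => o.elim P (Function.update b i₀ Q)
  have hb₁ : IsSparse b₁ := by
    let π : Option ι → ι := fun o => o.elim i₀ id
    have h1 : ∀ o e, b₁ o e ≠ 0 → b (π o) e ≠ 0 := by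
      rintro (_ | i) e h
      · exact hPF e h
      · by_cases hi : i = i₀
        · subst hi
          simp only [b₁, Option.elim, Function.update_self] at h
          exact hQF e h
        · simpa [b₁, π, hi] using h
    have h2 : ∀ o o' e, b₁ o e ≠ 0 → b₁ o' e ≠ 0 → π o = π o' → o = o' := by
      rintro (_ | i) (_ | j) e h h' hπ
      · rfl
      · simp only [π, Option.elim, id] at hπ
        subst hπ
        simp only [b₁, Option.elim, Function.update_self] at h h'
        exact (hPQ e h h').elim
      · simp only [π, Option.elim, id] at hπ
        subst hπ
        simp only [b₁, Option.elim, Function.update_self] at h h'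
        exact (hPQ e h' h).elim
      · simpa [π] using hπ
    intro e i j k hi hj hk
    rcases hb e _ _ _ (h1 i e hi) (h1 j e hj) (h1 k e hk) with h | h | h
    · exact Or.inl (h2 _ _ _ hi hj h)
    · exact Or.inr (Or.inl (h2 _ _ _ hj hk h))
    · exact Or.inr (Or.inr (h2 _ _ _ hi hk h))
  have hPD : boundaryTwo P = Pi.single x 1 + Pi.single z 1 := by
    rw [hP, map_add, boundaryTwo_single n1, boundaryTwo_single n2]
    funext v
    simp only [Pi.add_apply]
    linear_combination CharTwo.add_self_eq_zero ((Pi.single y 1 : V → ZMod 2) v)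
  have hPsupp : ∀ e, e ∉ G.edgeSet → P e = 0 := by
    intro e he
    by_contra h
    rcases hP' e h with rfl | rfl
    · exact he hxy
    · exact he hyz
  refine isMacLane_map_of_sparse hb₁ fun c => ?_
  have hbd : ∀ c : Sym2 V → ZMod 2,
      (∀ v, ∑ a, (if (if a = z then x else a) = v then boundaryTwo c a else 0) = 0) ↔
      boundaryTwo c x + boundaryTwo c z = 0 ∧ ∀ v, v ≠ x → v ≠ z → boundaryTwo c v = 0 := by
    intro c
    have h1 : ∀ v, v ≠ x → v ≠ z →
        ∑ a, (if (if a = z then x else a) = v then boundaryTwo c a else 0) = boundaryTwo c v := by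
      intro v hvx hvz
      rw [sum_eq_single v]
      · simp [hvz]
      · intro a _ hav
        by_cases haz : a = z
        · simp [haz, hvx.symm]
        · simp [haz, hav]
      · simp
    have h2 : ∑ a, (if (if a = z then x else a) = x then boundaryTwo c a else 0) =
        boundaryTwo c x + boundaryTwo c z := by
      rw [← sum_pair hxz, ← sum_subset (subset_univ {x, z})]
      · refine sum_congr rfl fun a ha => if_pos ?_
        simp only [mem_insert, mem_singleton] at ha
        rcases ha with rfl | rfl <;> simp [hxz]
      · intro a _ ha
        simp only [mem_insert, mem_singleton, not_or] at ha
        simp [ha.1, ha.2]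
    have h3 : ∑ a, (if (if a = z then x else a) = z then boundaryTwo c a else 0) = 0 := by
      refine sum_eq_zero fun a _ => if_neg ?_
      by_cases haz : a = z
      · simp [haz, hxz]
      · simp [haz]
    constructor
    · intro h
      exact ⟨h2 ▸ h x, fun v hvx hvz => h1 v hvx hvz ▸ h v⟩
    · rintro ⟨h, h'⟩ v
      by_cases hvx : v = x
      · rw [hvx, h2, h]
      · by_cases hvz : v = z
        · rw [hvz, h3]
        · rw [h1 v hvx hvz, h' v hvx hvz]
  rw [hbd]
  have hcyc : ∀ c, c ∈ G.cycleSpace → c ∈ span (ZMod 2) (Set.range b₁) := by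
    have hle : span (ZMod 2) (Set.range b) ≤ span (ZMod 2) (Set.range b₁) := by
      refine span_le.2 ?_
      rintro _ ⟨i, rfl⟩
      by_cases hi : i = i₀
      · rw [hi, hFPQ]
        refine add_mem (subset_span ⟨none, rfl⟩) (subset_span ⟨some i₀, ?_⟩)
        simp [b₁]
      · exact subset_span ⟨some i, by simp [b₁, hi]⟩
    intro c hc
    exact hle (hspan ▸ hc)
  constructor
  · have hle : span (ZMod 2) (Set.range b₁) ≤ G.cycleSpace ⊔ span (ZMod 2) {P} := by
      have hcy : ∀ i, b i ∈ G.cycleSpace := fun i => hspan ▸ subset_span ⟨i, rfl⟩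
      refine span_le.2 ?_
      rintro _ ⟨_ | i, rfl⟩
      · exact mem_sup_right (subset_span rfl)
      · by_cases hi : i = i₀
        · have : b₁ (some i) = b i₀ - P := by
            rw [hFPQ, add_sub_cancel_left, hi]
            simp [b₁]
          rw [this]
          exact sub_mem (mem_sup_left (hcy i₀)) (mem_sup_right (subset_span rfl))
        · have : b₁ (some i) = b i := by simp [b₁, hi]
          rw [this]
          exact mem_sup_left (hcy i)
    intro hc
    obtain ⟨d, hd, p, hp, rfl⟩ := mem_sup.1 (hle hc)
    obtain ⟨r, rfl⟩ := mem_span_singleton.1 hp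
    rw [mem_cycleSpace] at hd
    have hd0 : boundaryTwo d = 0 := funext hd.2
    refine ⟨fun e he => by simp [hd.1 e he, hPsupp e he], ?_, fun v hvx hvz => ?_⟩
    · simp [hd0, hPD, hxz, hxz.symm]
      exact CharTwo.add_self_eq_zero _
    · simp [hd0, hPD, hvx, hvz]
  · rintro ⟨hc1, hc2, hc3⟩
    by_cases hcx : boundaryTwo c x = 0
    · refine hcyc c (mem_cycleSpace.2 ⟨hc1, fun v => ?_⟩)
      by_cases hvx : v = x
      · rw [hvx]
        exact hcx
      · by_cases hvz : v = z
        · rw [hcx, zero_add] at hc2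
          rw [hvz]
          exact hc2
        · exact hc3 v hvx hvz
    · rw [ZMod.eq_one_of_ne_zero_two hcx] at hc2
      have hcz : boundaryTwo c z = 1 := by
        linear_combination hc2 - CharTwo.add_self_eq_zero (1 : ZMod 2)
      have hmem : c + P ∈ G.cycleSpace := by
        refine mem_cycleSpace.2 ⟨fun e he => by simp [hc1 e he, hPsupp e he], fun v => ?_⟩
        rw [← boundaryTwo_apply, map_add, hPD]
        by_cases hvx : v = x
        · subst hvx
          simp [ZMod.eq_one_of_ne_zero_two hcx, hxz]
          exact CharTwo.add_self_eq_zero _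
        · by_cases hvz : v = z
          · subst hvz
            simp [hcz, hxz.symm]
            exact CharTwo.add_self_eq_zero _
          · simp [hc3 v hvx hvz, hvx, hvz]
      have : c = c + P - P := by simp
      rw [this]
      exact sub_mem (hcyc _ hmem) (subset_span ⟨none, rfl⟩)

end SimpleGraph

lemma Submodule.exists_ne_zero_of_mem_span {R M N ι : Type*} [Semiring R] [AddCommMonoid M]
    [AddCommMonoid N] [Module R M] [Module R N] {b : ι → M} {c : M}
    (hc : c ∈ Submodule.span R (Set.range b)) (f : M →ₗ[R] N) (hf : f c ≠ 0) :
    ∃ i, f (b i) ≠ 0 := by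
  by_contra! h
  refine hf (LinearMap.mem_ker.1 ((Submodule.span_le (p := LinearMap.ker f)).2 ?_ hc))
  rintro _ ⟨i, rfl⟩
  exact h i

set_option synthInstance.maxHeartbeats 200000 in
set_option synthInstance.maxSize 2000 in
lemma ZMod.eq_of_disjoint_two : ∀ p q r p' q' r' : ZMod 2,
    ¬ (p ≠ 0 ∧ p' ≠ 0) → ¬ (q ≠ 0 ∧ q' ≠ 0) → ¬ (r ≠ 0 ∧ r' ≠ 0) →
    ¬ (p + q + r ≠ 0 ∧ p' + q' + r' ≠ 0) → (p + q ≠ 0 ∨ q + r ≠ 0) →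
    (p' + q' ≠ 0 ∨ q' + r' ≠ 0) → p + q = p' + q' ∧ q + r = q' + r' := by
  decide

namespace SimpleGraph

open Finset Submodule

lemma CliqueFree.not_triangle {G : SimpleGraph V} (hG : G.CliqueFree 3) {a b d : V}
    (hab : G.Adj a b) (hbd : G.Adj b d) (hda : G.Adj d a) : False := by
  classical
  exact hG {a, b, d} (is3Clique_triple_iff.2 ⟨hab, hda.symm, hbd⟩)

lemma exists_path_of_not_cliqueFree_map [DecidableEq V] {G : SimpleGraph V}
    (hG : G.CliqueFree 3) {x z : V} (hxz : x ≠ z)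
    (h : ¬ (G.map fun w => if w = z then x else w).CliqueFree 3) :
    ∃ v w, G.Adj x v ∧ G.Adj v w ∧ G.Adj w z := by
  set G' := G.map fun w => if w = z then x else w with hG'
  have h1 : ∀ a b, G'.Adj a b → a ≠ x → b ≠ x → G.Adj a b := by
    intro a b hab ha hb
    obtain ⟨-, a', b', hab', rfl, rfl⟩ := (map_adj' _ _ _ _).1 hab
    grind
  have h2 : ∀ b, G'.Adj x b → G.Adj x b ∨ G.Adj z b := by
    intro b hab
    obtain ⟨h0, a', b', hab', h3, rfl⟩ := (map_adj' _ _ _ _).1 hab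
    grind
  have h3 : ∀ b c, G'.Adj x b → G'.Adj x c → G'.Adj b c →
      ∃ v w, G.Adj x v ∧ G.Adj v w ∧ G.Adj w z := by
    intro b c hb hc hbc
    have hbc' := h1 b c hbc hb.ne' hc.ne'
    rcases h2 b hb with hb' | hb' <;> rcases h2 c hc with hc' | hc'
    · exact (hG.not_triangle hb' hbc' hc'.symm).elim
    · exact ⟨b, c, hb', hbc', hc'.symm⟩
    · exact ⟨c, b, hc', hbc'.symm, hb'.symm⟩
    · exact (hG.not_triangle hb' hbc' hc'.symm).elim
  simp only [CliqueFree, not_forall, not_not] at h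
  obtain ⟨s, hs⟩ := h
  obtain ⟨a, b, c, hab, hac, hbc, -⟩ := is3Clique_iff.1 hs
  by_cases ha : a = x
  · subst ha
    exact h3 b c hab hac hbc
  by_cases hb : b = x
  · subst hb
    exact h3 a c hab.symm hbc hac
  by_cases hc : c = x
  · subst hc
    exact h3 a b hac.symm hbc.symm hab
  exact (hG.not_triangle (h1 _ _ hab ha hb) (h1 _ _ hbc hb hc) (h1 _ _ hac.symm hc ha)).elim

variable [Fintype V] {G : SimpleGraph V}

/-- Opposite pairs of corners of a face of length four are not both joined by paths of length
three. -/
lemma false_of_crossing_paths [DecidableEq V] (hG : G.CliqueFree 3) {ι : Type} [Finite ι]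
    {b : ι → Sym2 V → ZMod 2} (hb : IsSparse b)
    (hspan : span (ZMod 2) (Set.range b) = G.cycleSpace) {x y z u v w v' w' : V}
    (hxy : G.Adj x y) (hyz : G.Adj y z) (hzu : G.Adj z u) (hux : G.Adj u x)
    (hxz : x ≠ z) (hyu : y ≠ u) {i₀ : ι} (hF : b i₀ = fourCycle x y z u)
    (hxv : G.Adj x v) (hvw : G.Adj v w) (hwz : G.Adj w z)
    (hyv' : G.Adj y v') (hvw' : G.Adj v' w') (hwu' : G.Adj w' u) : False := by
  have n1 := hxy.ne
  have n2 := hyz.ne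
  have n3 := hzu.ne
  have n4 := hux.ne
  have n5 := hxv.ne
  have n6 := hvw.ne
  have n7 := hwz.ne
  have n8 := hyv'.ne
  have n9 := hvw'.ne
  have n10 := hwu'.ne
  have m1 : v ≠ y := by rintro rfl; exact hG.not_triangle hvw hwz hyz.symm
  have m2 : v ≠ u := by rintro rfl; exact hG.not_triangle hvw hwz hzu
  have m3 : v ≠ z := by rintro rfl; exact hG.not_triangle hxv hyz.symm hxy.symm
  have m4 : w ≠ x := by rintro rfl; exact hG.not_triangle hxy hyz hwz.symm
  have m5 : w ≠ y := by rintro rfl; exact hG.not_triangle hxv hvw hxy.symm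
  have m6 : w ≠ u := by rintro rfl; exact hG.not_triangle hxv hvw hux
  have m7 : v' ≠ x := by rintro rfl; exact hG.not_triangle hvw' hwu' hux
  have m8 : v' ≠ z := by rintro rfl; exact hG.not_triangle hvw' hwu' hzu.symm
  have m9 : v' ≠ u := by rintro rfl; exact hG.not_triangle hyv' hux hxy
  have m10 : w' ≠ y := by rintro rfl; exact hG.not_triangle hyz hzu hwu'.symm
  have m11 : w' ≠ x := by rintro rfl; exact hG.not_triangle hyv' hvw' hxy
  have m12 : w' ≠ z := by rintro rfl; exact hG.not_triangle hyv' hvw' hyz.symm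
  have m13 : v ≠ v' := by rintro rfl; exact hG.not_triangle hxv hyv'.symm hxy.symm
  have m14 : v ≠ w' := by rintro rfl; exact hG.not_triangle hxv hwu' hux
  have m15 : w ≠ v' := by rintro rfl; exact hG.not_triangle hwz hyz.symm hyv'
  have m16 : w ≠ w' := by rintro rfl; exact hG.not_triangle hwz hzu hwu'.symm
  set L : Finset (Sym2 V) := {s(x, y), s(y, z), s(z, u), s(u, x), s(x, v), s(v, w), s(w, z),
    s(y, v'), s(v', w'), s(w', u)} with hL
  obtain ⟨b', hb', hspan', hfix⟩ := hb.exists_vanishOn {e | e ∉ L}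
  have hF0 : ∀ e, fourCycle x y z u e ≠ 0 →
      e = s(x, y) ∨ e = s(y, z) ∨ e = s(z, u) ∨ e = s(u, x) := by
    intro e he
    by_contra! h
    exact he (by simp [fourCycle, h.1, h.2.1, h.2.2.1, h.2.2.2])
  have hF' : b' i₀ = fourCycle x y z u := by
    rw [← hF]
    refine hfix _ fun e he => ?_
    by_contra h
    rw [hF] at h
    refine he ?_
    rcases hF0 e h with rfl | rfl | rfl | rfl <;> simp [hL]
  have two : ∀ (c : Sym2 V → ZMod 2) (s a b : V), a ≠ b → (∑ t, c s(s, t) = 0) →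
      (∀ t, c s(s, t) ≠ 0 → t = a ∨ t = b) → c s(s, a) + c s(s, b) = 0 := by
    intro c s a b hab h1 h2
    rw [← h1, ← sum_pair (f := fun t => c s(s, t)) hab]
    refine sum_subset (subset_univ _) fun t _ ht => ?_
    by_contra h
    exact ht (by simpa using h2 t h)
  have three : ∀ (c : Sym2 V → ZMod 2) (s a b d : V), a ≠ b → a ≠ d → b ≠ d →
      (∑ t, c s(s, t) = 0) → (∀ t, c s(s, t) ≠ 0 → t = a ∨ t = b ∨ t = d) →
      c s(s, a) + (c s(s, b) + c s(s, d)) = 0 := by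
    intro c s a b d hab had hbd h1 h2
    rw [← h1, ← sum_pair (f := fun t => c s(s, t)) hbd,
      ← sum_insert (f := fun t => c s(s, t)) (a := a) (by simp [hab, had])]
    refine sum_subset (subset_univ _) fun t _ ht => ?_
    by_contra h
    exact ht (by simpa using h2 t h)
  have eq_of_add : ∀ {a b : ZMod 2}, a + b = 0 → a = b := fun h => CharTwo.add_eq_zero.1 h
  have key : ∀ i, b' i s(u, x) + b' i s(x, y) = b' i s(x, v) ∧
      b' i s(x, y) + b' i s(y, z) = b' i s(y, v') ∧
      b' i s(z, u) = b' i s(u, x) + b' i s(x, y) + b' i s(y, z) := by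
    intro i
    have hi : b' i ∈ G.cycleSpace ⊓ vanishOn {e | e ∉ L} := by
      rw [← hspan, ← hspan']
      exact subset_span ⟨i, rfl⟩
    obtain ⟨hi1, hi2⟩ := hi
    have hi1 := (mem_cycleSpace.1 hi1).2
    have hi3 : ∀ e, b' i e ≠ 0 → e ∈ L := fun e he => by
      by_contra h
      exact he (hi2 e h)
    simp only [hL, mem_insert, mem_singleton] at hi3
    have e1 := two (b' i) v x w m4.symm (hi1 v) fun t ht => by
      have := hi3 _ ht
      simp only [Sym2.eq_iff] at this
      grind
    have e2 := two (b' i) w v z m3 (hi1 w) fun t ht => by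
      have := hi3 _ ht
      simp only [Sym2.eq_iff] at this
      grind
    have e3 := two (b' i) v' y w' m10.symm (hi1 v') fun t ht => by
      have := hi3 _ ht
      simp only [Sym2.eq_iff] at this
      grind
    have e4 := two (b' i) w' v' u m9 (hi1 w') fun t ht => by
      have := hi3 _ ht
      simp only [Sym2.eq_iff] at this
      grind
    have e5 := three (b' i) x v u y m2 m1 hyu.symm (hi1 x) fun t ht => by
      have := hi3 _ ht
      simp only [Sym2.eq_iff] at this
      grind
    have e6 := three (b' i) y v' x z m7 m8 hxz (hi1 y) fun t ht => by
      have := hi3 _ ht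
      simp only [Sym2.eq_iff] at this
      grind
    have e7 := three (b' i) z w y u m5 m6 hyu (hi1 z) fun t ht => by
      have := hi3 _ ht
      simp only [Sym2.eq_iff] at this
      grind
    rw [Sym2.eq_swap (a := v) (b := x)] at e1
    rw [Sym2.eq_swap (a := w) (b := v)] at e2
    rw [Sym2.eq_swap (a := x) (b := u)] at e5
    rw [Sym2.eq_swap (a := y) (b := x)] at e6
    rw [Sym2.eq_swap (a := z) (b := w), Sym2.eq_swap (a := z) (b := y)] at e7
    have e1 := eq_of_add e1
    have e2 := eq_of_add e2
    have e5 := eq_of_add e5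
    have e6 := eq_of_add e6
    have e7 := eq_of_add e7
    refine ⟨e5.symm, e6.symm, ?_⟩
    rw [← e5, e1, e2, e7, add_comm (b' i s(y, z)), add_assoc, CharTwo.add_self_eq_zero, add_zero]
  have hne : ∀ e i j, fourCycle x y z u e ≠ 0 → i ≠ i₀ → j ≠ i₀ → i ≠ j →
      ¬ (b' i e ≠ 0 ∧ b' j e ≠ 0) := by
    rintro e i j he hi hj hij ⟨h1, h2⟩
    have := hb' e i j i₀ h1 h2 (hF' ▸ he)
    tauto
  have f1 : fourCycle x y z u s(u, x) ≠ 0 := by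
    simp [fourCycle, Pi.single_apply]
    grind
  have f2 : fourCycle x y z u s(x, y) ≠ 0 := by
    simp [fourCycle, Pi.single_apply]
    grind
  have f3 : fourCycle x y z u s(y, z) ≠ 0 := by
    simp [fourCycle, Pi.single_apply]
    grind
  have f4 : fourCycle x y z u s(z, u) ≠ 0 := by
    simp [fourCycle, Pi.single_apply]
    grind
  have f5 : fourCycle x y z u s(x, v) = 0 := by
    by_contra h
    have := hF0 _ h
    simp only [Sym2.eq_iff] at this
    grind
  have f6 : fourCycle x y z u s(y, v') = 0 := by
    by_contra h
    have := hF0 _ h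
    simp only [Sym2.eq_iff] at this
    grind
  have htype : ∀ i j, (b' i s(x, v) ≠ 0 ∨ b' i s(y, v') ≠ 0) →
      (b' j s(x, v) ≠ 0 ∨ b' j s(y, v') ≠ 0) →
      b' i s(x, v) = b' j s(x, v) ∧ b' i s(y, v') = b' j s(y, v') := by
    intro i j hi hj
    by_cases hij : i = j
    · subst hij
      exact ⟨rfl, rfl⟩
    have hi₀ : i ≠ i₀ := by
      rintro rfl
      rw [hF', f5, f6] at hi
      simp at hi
    have hj₀ : j ≠ i₀ := by
      rintro rfl
      rw [hF', f5, f6] at hj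
      simp at hj
    obtain ⟨k1, k2, k3⟩ := key i
    obtain ⟨k1', k2', k3'⟩ := key j
    rw [← k1, ← k2] at hi ⊢
    rw [← k1', ← k2'] at hj ⊢
    have h4 := hne _ i j f4 hi₀ hj₀ hij
    rw [k3, k3'] at h4
    exact ZMod.eq_of_disjoint_two _ _ _ _ _ _ (hne _ i j f1 hi₀ hj₀ hij)
      (hne _ i j f2 hi₀ hj₀ hij) (hne _ i j f3 hi₀ hj₀ hij) h4 hi hj
  have hfive : ∀ s a b d e : V, s ≠ a → a ≠ b → b ≠ d → d ≠ e → e ≠ s → G.Adj s a → G.Adj a b →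
      G.Adj b d → G.Adj d e → G.Adj e s →
      s(s, a) ∈ L → s(a, b) ∈ L → s(b, d) ∈ L → s(d, e) ∈ L → s(e, s) ∈ L →
      (Pi.single s(s, a) 1 + Pi.single s(a, b) 1 + Pi.single s(b, d) 1 + Pi.single s(d, e) 1 +
        Pi.single s(e, s) 1 : Sym2 V → ZMod 2) ∈ span (ZMod 2) (Set.range b') := by
    intro s a b d e h1 h2 h3 h4 h5 a1 a2 a3 a4 a5 l1 l2 l3 l4 l5
    rw [hspan', hspan]
    have hz : ∀ f ∉ ({s(s, a), s(a, b), s(b, d), s(d, e), s(e, s)} : Finset (Sym2 V)),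
        (Pi.single s(s, a) 1 + Pi.single s(a, b) 1 + Pi.single s(b, d) 1 + Pi.single s(d, e) 1 +
        Pi.single s(e, s) 1 : Sym2 V → ZMod 2) f = 0 := by
      intro f hf
      simp only [mem_insert, mem_singleton, not_or] at hf
      simp [hf.1, hf.2.1, hf.2.2.1, hf.2.2.2.1, hf.2.2.2.2]
    refine ⟨mem_cycleSpace.2 ⟨fun f hf => hz f fun h => hf ?_, fun t => ?_⟩,
      fun f hf => hz f fun h => hf ?_⟩
    · simp only [mem_insert, mem_singleton] at h
      rcases h with rfl | rfl | rfl | rfl | rfl <;> assumption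
    · rw [← boundaryTwo_apply]
      simp only [map_add, boundaryTwo_single h1, boundaryTwo_single h2, boundaryTwo_single h3,
        boundaryTwo_single h4, boundaryTwo_single h5, Pi.add_apply]
      generalize (Pi.single s 1 : V → ZMod 2) t = p1
      generalize (Pi.single a 1 : V → ZMod 2) t = p2
      generalize (Pi.single b 1 : V → ZMod 2) t = p3
      generalize (Pi.single d 1 : V → ZMod 2) t = p4
      generalize (Pi.single e 1 : V → ZMod 2) t = p5
      revert p1 p2 p3 p4 p5
      decide
    · simp only [mem_insert, mem_singleton] at h
      rcases h with rfl | rfl | rfl | rfl | rfl <;> assumption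
  have hA := hfive x v w z y n5 n6 n7 n2.symm n1.symm hxv hvw hwz hyz.symm hxy.symm
    (by simp [hL]) (by simp [hL]) (by simp [hL]) (by simp [hL, Sym2.eq_swap (a := z) (b := y)])
    (by simp [hL, Sym2.eq_swap (a := y) (b := x)])
  have hB := hfive y v' w' u x n8 n9 n10 n4 n1 hyv' hvw' hwu' hux hxy
    (by simp [hL]) (by simp [hL]) (by simp [hL]) (by simp [hL]) (by simp [hL])
  have hA0 : (Pi.single s(x, v) 1 + Pi.single s(v, w) 1 + Pi.single s(w, z) 1 +
      Pi.single s(z, y) 1 + Pi.single s(y, x) 1 : Sym2 V → ZMod 2) s(y, v') = 0 := by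
    simp [Pi.single_apply]
    grind
  have hA1 : (Pi.single s(x, v) 1 + Pi.single s(v, w) 1 + Pi.single s(w, z) 1 +
      Pi.single s(z, y) 1 + Pi.single s(y, x) 1 : Sym2 V → ZMod 2) s(x, v) ≠ 0 := by
    simp [Pi.single_apply]
    grind
  obtain ⟨i, hi⟩ := exists_ne_zero_of_mem_span hA (LinearMap.proj s(x, v)) hA1
  obtain ⟨j, hj⟩ := exists_ne_zero_of_mem_span hB (LinearMap.proj s(y, v')) (by
    simp [Pi.single_apply]
    grind)
  obtain ⟨k, hk⟩ := exists_ne_zero_of_mem_span hA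
    ((LinearMap.proj s(x, v) : (Sym2 V → ZMod 2) →ₗ[ZMod 2] ZMod 2) +
      (LinearMap.proj s(y, v') : (Sym2 V → ZMod 2) →ₗ[ZMod 2] ZMod 2)) (by
    rw [LinearMap.add_apply, LinearMap.proj_apply, LinearMap.proj_apply, hA0, add_zero]
    exact hA1)
  simp only [LinearMap.proj_apply, LinearMap.add_apply] at hi hj hk
  have hk' : b' k s(x, v) ≠ 0 ∨ b' k s(y, v') ≠ 0 := by
    by_contra! h
    rw [h.1, h.2] at hk
    exact hk (add_zero 0)
  have t1 := htype i k (Or.inl hi) hk'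
  have t2 := htype j k (Or.inr hj) hk'
  rw [← t1.1, ← t2.2, ZMod.eq_one_of_ne_zero_two hi, ZMod.eq_one_of_ne_zero_two hj] at hk
  exact hk (CharTwo.add_self_eq_zero _)

end SimpleGraph

namespace SimpleGraph

open Finset Submodule

lemma fourCycle_rotate [DecidableEq V] (x y z u : V) : fourCycle x y z u = fourCycle y z u x := by
  unfold fourCycle
  abel

lemma colorable_of_map {G : SimpleGraph V} [DecidableEq V] {x z : V} (hxz : ¬ G.Adj x z) {n : ℕ}
    (h : (G.map fun w => if w = z then x else w).Colorable n) : G.Colorable n := by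
  obtain ⟨φ⟩ := h
  refine ⟨Coloring.mk (fun w => φ (if w = z then x else w)) fun {a b} hab => ?_⟩
  refine φ.valid ((map_adj' _ _ _ _).2 ⟨?_, a, b, hab, rfl, rfl⟩)
  have := hab.symm
  have := hab.ne
  grind

lemma card_dartsOn_eq_of_forall_mem {G : SimpleGraph V} [Fintype V] [DecidableEq V]
    [DecidableRel G.Adj] {R : Finset V} (hR : ∀ v w, G.Adj v w → v ∈ R) :
    #(G.dartsOn R) = 2 * #G.edgeFinset := by
  rw [← G.dart_card_eq_twice_card_edges, ← card_univ]
  symm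
  refine card_bij (fun d _ => d.toProd) (fun d _ => mem_dartsOn.2
    ⟨⟨hR _ _ d.adj, hR _ _ d.adj.symm⟩, d.adj⟩) (fun d _ d' _ h => Dart.ext _ _ h) fun p hp => ?_
  exact ⟨⟨p, (mem_dartsOn.1 hp).2⟩, mem_univ _, rfl⟩

variable [Fintype V]

lemma ncard_edgeSet_map_lt [DecidableEq V] {G : SimpleGraph V} {x y z : V} (hxy : G.Adj x y)
    (hyz : G.Adj y z) (hxz : x ≠ z) :
    (G.map fun w => if w = z then x else w).edgeSet.ncard < G.edgeSet.ncard := by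
  have h1 : (G.map fun w => if w = z then x else w).edgeSet ⊆
      (Sym2.map fun w => if w = z then x else w) '' (G.edgeSet \ {s(y, z)}) := by
    intro e he
    induction e with
    | _ a b =>
      obtain ⟨-, a', b', hab', rfl, rfl⟩ := (map_adj' _ _ _ _).1 he
      by_cases h : s(a', b') = s(y, z)
      · refine ⟨s(y, x), ⟨hxy.symm, ?_⟩, ?_⟩
        · simp [hxz, hyz.ne]
        · have h2 := congrArg (Sym2.map fun w => if w = z then x else w) h
          simp only [Sym2.map_mk] at h2 ⊢
          rw [h2, if_pos trivial, if_neg hxz]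
      · exact ⟨s(a', b'), ⟨hab', h⟩, rfl⟩
  refine ((Set.ncard_le_ncard h1).trans Set.ncard_image_le).trans_lt ?_
  exact Set.ncard_sdiff_singleton_lt_of_mem hyz

open scoped Classical in
/-- Triangle-free graphs satisfying MacLane's planarity condition are 3-colorable. -/
theorem IsMacLane.colorable_three {G : SimpleGraph V} (hG : G.IsMacLane) (htf : G.CliqueFree 3) :
    G.Colorable 3 := by
  induction hn : G.edgeSet.ncard using Nat.strong_induction_on generalizing G with
  | _ n ih =>
    by_contra hcol
    obtain ⟨W, -, hW, hpot⟩ := exists_potential_le _ G univ rfl (by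
      rintro ⟨φ, hφ⟩
      exact hcol ⟨Coloring.mk φ fun {a b} hab => hφ a (mem_univ _) b (mem_univ _) hab⟩)
    let H : SimpleGraph V :=
      { Adj := fun a b => G.Adj a b ∧ a ∈ W ∧ b ∈ W
        symm := ⟨fun a b h => ⟨h.1.symm, h.2.2, h.2.1⟩⟩
        loopless := ⟨fun a h => h.1.ne rfl⟩ }
    have hHG : H ≤ G := fun a b h => h.1
    have hHtf : H.CliqueFree 3 := htf.anti hHG
    have hHcol : ¬ H.Colorable 3 := by
      rintro ⟨φ⟩
      exact hW ⟨φ, fun a ha b hb hab => φ.valid (v := a) (w := b) ⟨hab, ha, hb⟩⟩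
    have hdarts : G.dartsOn W = H.dartsOn W := by
      ext p
      simp [H]
      tauto
    have hWne : W.Nonempty := by
      rw [nonempty_iff_ne_empty]
      rintro rfl
      exact hW (threeColorableOn_of_card_le _ (by simp))
    have hHW : ∀ v w, H.Adj v w → v ∈ W := fun v w h => h.2.1
    rw [potential, hdarts, card_dartsOn_eq_of_forall_mem hHW] at hpot
    obtain ⟨ι, _, b, hb, hspan, i₀, hi₀, hcard⟩ := (hG.mono hHG).exists_short hWne hHW (by
      push_cast at hpot
      omega)
    obtain ⟨x, y, z, u, hxy, hyz, hzu, hux, hxz, hyu, hF⟩ :=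
      exists_four_cycle hHtf (hspan ▸ subset_span ⟨i₀, rfl⟩ : b i₀ ∈ H.cycleSpace) hi₀ hcard
    have hF' : b i₀ = fourCycle x y z u := by
      have h1 := hxy.ne
      have h2 := hyz.ne
      have h3 := hzu.ne
      have h4 := hux.ne
      ext e
      by_cases he : b i₀ e = 0
      · have := mt (hF e).2 (not_not.2 he)
        push Not at this
        simp [he, fourCycle, this]
      · rw [ZMod.eq_one_of_ne_zero_two he]
        rcases (hF e).1 he with rfl | rfl | rfl | rfl <;>
          simp [fourCycle, Pi.single_apply] <;> grind
    have hle : H.edgeSet.ncard ≤ G.edgeSet.ncard := Set.ncard_le_ncard (edgeSet_mono hHG)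
    have h1 := isMacLane_map_of_fourCycle hb hspan hxy hyz hzu hux hxz hyu hF'
    have h2 := isMacLane_map_of_fourCycle hb hspan hyz hzu hux hxy hyu hxz.symm
      (hF'.trans (fourCycle_rotate x y z u))
    have c1 := ncard_edgeSet_map_lt hxy hyz hxz
    have c2 := ncard_edgeSet_map_lt hyz hzu hyu
    have p1 : ¬ (H.map fun w => if w = z then x else w).CliqueFree 3 := fun h =>
      hHcol (colorable_of_map (fun h => hHtf.not_triangle hxy hyz h.symm)
        (ih _ (by omega) h1 h rfl))
    have p2 : ¬ (H.map fun w => if w = u then y else w).CliqueFree 3 := fun h =>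
      hHcol (colorable_of_map (fun h => hHtf.not_triangle hyz hzu h.symm)
        (ih _ (by omega) h2 h rfl))
    obtain ⟨v, w, hxv, hvw, hwz⟩ := exists_path_of_not_cliqueFree_map hHtf hxz p1
    obtain ⟨v', w', hyv', hvw', hwu'⟩ := exists_path_of_not_cliqueFree_map hHtf hyu p2
    exact false_of_crossing_paths hHtf hb hspan hxy hyz hzu hux hxz hyu hF' hxv hvw hwz hyv' hvw'
      hwu'

end SimpleGraph

section Grid

open Finset

/-- Edges of the integer grid: `(true, p)` joins `p` to `p + (1, 0)` and `(false, p)` joins `p` to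
`p + (0, 1)`. -/
abbrev GridEdge : Type := Bool × ℤ × ℤ

namespace GridEdge

/-- The first endpoint of a grid edge. -/
def src (e : GridEdge) : ℤ × ℤ := e.2

/-- The second endpoint of a grid edge. -/
def tgt : GridEdge → ℤ × ℤ
  | (true, i, j) => (i + 1, j)
  | (false, i, j) => (i, j + 1)

end GridEdge

open GridEdge

/-- Adjacency in the integer grid. -/
def GridAdj (p q : ℤ × ℤ) : Prop :=
  ∃ e : GridEdge, e.src = p ∧ e.tgt = q ∨ e.src = q ∧ e.tgt = p

/-- The boundary map of the integer grid over `ZMod 2`. -/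
def gridBoundary : (GridEdge → ZMod 2) →ₗ[ZMod 2] (ℤ × ℤ → ZMod 2) where
  toFun c p := c (true, p.1, p.2) + c (true, p.1 - 1, p.2) +
    (c (false, p.1, p.2) + c (false, p.1, p.2 - 1))
  map_add' c d := by ext p; simp; ring
  map_smul' r c := by ext p; simp; ring

lemma gridBoundary_apply (c : GridEdge → ZMod 2) (i j : ℤ) : gridBoundary c (i, j) =
    c (true, i, j) + c (true, i - 1, j) + (c (false, i, j) + c (false, i, j - 1)) := rfl

lemma gridBoundary_single (e : GridEdge) :
    gridBoundary (Pi.single e 1) = Pi.single e.src 1 + Pi.single e.tgt 1 := by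
  obtain ⟨_ | _, i, j⟩ := e <;> ext ⟨k, l⟩ <;>
    simp [gridBoundary_apply, Pi.single_apply, src, tgt, sub_eq_iff_eq_add]

/-- The sum of unit squares with prescribed coefficients. -/
def gridSquares : (ℤ × ℤ → ZMod 2) →ₗ[ZMod 2] (GridEdge → ZMod 2) where
  toFun a
    | (true, i, j) => a (i, j) + a (i, j - 1)
    | (false, i, j) => a (i, j) + a (i - 1, j)
  map_add' a b := by ext ⟨_ | _, i, j⟩ <;> simp <;> ring
  map_smul' r a := by ext ⟨_ | _, i, j⟩ <;> simp <;> ring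

lemma gridSquares_true (a : ℤ × ℤ → ZMod 2) (i j : ℤ) :
    gridSquares a (true, i, j) = a (i, j) + a (i, j - 1) := rfl

lemma gridSquares_false (a : ℤ × ℤ → ZMod 2) (i j : ℤ) :
    gridSquares a (false, i, j) = a (i, j) + a (i - 1, j) := rfl

lemma gridSquares_single (i j : ℤ) : gridSquares (Pi.single (i, j) 1) =
    Pi.single (true, i, j) 1 + Pi.single (true, i, j + 1) 1 +
      (Pi.single (false, i, j) 1 + Pi.single (false, i + 1, j) 1) := by
  ext ⟨_ | _, k, l⟩
  · simp [gridSquares_false, Pi.single_apply, sub_eq_iff_eq_add]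
  · simp [gridSquares_true, Pi.single_apply, sub_eq_iff_eq_add]

lemma isSparse_gridSquares (W : Finset (ℤ × ℤ)) :
    IsSparse fun p : W => gridSquares (Pi.single p.1 1) := by
  have h1 : ∀ (p : ℤ × ℤ) (i j : ℤ), gridSquares (Pi.single p 1) (true, i, j) ≠ 0 →
      p = (i, j) ∨ p = (i, j - 1) := by
    intro p i j h
    rw [gridSquares_true] at h
    by_contra! h'
    exact h (by simp [h'.1.symm, h'.2.symm])
  have h2 : ∀ (p : ℤ × ℤ) (i j : ℤ), gridSquares (Pi.single p 1) (false, i, j) ≠ 0 →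
      p = (i, j) ∨ p = (i - 1, j) := by
    intro p i j h
    rw [gridSquares_false] at h
    by_contra! h'
    exact h (by simp [h'.1.symm, h'.2.symm])
  rintro ⟨_ | _, i, j⟩ p q r hp hq hr
  · have hp := h2 _ _ _ hp
    have hq := h2 _ _ _ hq
    have hr := h2 _ _ _ hr
    simp only [Subtype.ext_iff]
    grind
  · have hp := h1 _ _ _ hp
    have hq := h1 _ _ _ hq
    have hr := h1 _ _ _ hr
    simp only [Subtype.ext_iff]
    grind

lemma gridSquares_mem_span {W : Finset (ℤ × ℤ)} {a : ℤ × ℤ → ZMod 2}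
    (ha : ∀ p, a p ≠ 0 → p ∈ W) : gridSquares a ∈
      Submodule.span (ZMod 2) (Set.range fun p : W => gridSquares (Pi.single p.1 1)) := by
  have : a = ∑ p ∈ W, a p • Pi.single p 1 := by
    ext p
    simp only [Finset.sum_apply, Pi.smul_apply, Pi.single_apply, smul_eq_mul, mul_ite, mul_one,
      mul_zero, sum_ite_eq]
    split_ifs with h
    · rfl
    · by_contra h'
      exact h (ha p h')
  rw [this, map_sum]
  refine sum_mem fun p hp => ?_
  rw [map_smul]
  exact Submodule.smul_mem _ _ (Submodule.subset_span ⟨⟨p, hp⟩, rfl⟩)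

lemma sum_Ico_add_sum_Ico_pred {f : ℤ → ZMod 2} {a j : ℤ} (hf : ∀ l < a, f l = 0) :
    ∑ l ∈ Ico a (j + 1), f l + ∑ l ∈ Ico a j, f l = f j := by
  rcases le_or_gt a j with h | h
  · have h1 : Ico a (j + 1) = insert j (Ico a j) := by ext; simp; omega
    rw [h1, sum_insert (by simp), add_assoc, CharTwo.add_self_eq_zero, add_zero]
  · rw [Ico_eq_empty (by omega), Ico_eq_empty (by omega), hf j h]
    simp

/-- Finitely supported cycles of the grid are finite sums of unit squares. -/
lemma exists_gridSquares_eq {c : GridEdge → ZMod 2} (hc : {e | c e ≠ 0}.Finite)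
    (hb : gridBoundary c = 0) :
    ∃ a : ℤ × ℤ → ZMod 2, {p | a p ≠ 0}.Finite ∧ gridSquares a = c := by
  obtain ⟨N, hN⟩ : ∃ N : ℤ, ∀ b i j, c (b, i, j) ≠ 0 → -N ≤ i ∧ i < N ∧ -N ≤ j ∧ j < N := by
    obtain ⟨N, hN⟩ := (hc.image fun e => max |e.2.1| |e.2.2|).bddAbove
    refine ⟨N + 1, fun b i j h => ?_⟩
    have := hN ⟨(b, i, j), h, rfl⟩
    simp only [max_le_iff, abs_le] at this
    omega
  have hb' : ∀ i j, c (true, i, j) + c (true, i - 1, j) = c (false, i, j) + c (false, i, j - 1) :=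
    fun i j => CharTwo.add_eq_zero.1 (congr_fun hb (i, j))
  have h0 : ∀ b i j, ¬ (-N ≤ i ∧ i < N ∧ -N ≤ j ∧ j < N) → c (b, i, j) = 0 := by
    intro b i j h
    by_contra h'
    exact h (hN b i j h')
  set a : ℤ × ℤ → ZMod 2 := fun p => ∑ l ∈ Ico (-N) (p.2 + 1), c (true, p.1, l) with ha
  have htrue : ∀ i j, a (i, j) + a (i, j - 1) = c (true, i, j) := by
    intro i j
    simp only [ha, sub_add_cancel]
    exact sum_Ico_add_sum_Ico_pred fun l hl => h0 _ _ _ (by omega)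
  have hfalse : ∀ i j, a (i, j) + a (i - 1, j) = c (false, i, j) := by
    intro i j
    simp only [ha]
    rw [← sum_add_distrib, sum_congr rfl fun l _ => hb' i l, sum_add_distrib]
    have h1 : ∑ l ∈ Ico (-N) (j + 1), c (false, i, l - 1) =
        ∑ l ∈ Ico (-N) j, c (false, i, l) := by
      have h2 : ∑ l ∈ Ico (-N) (j + 1), c (false, i, l - 1) =
          ∑ l ∈ Ico (-N - 1) j, c (false, i, l) := by
        refine sum_bij (fun l _ => l - 1) ?_ ?_ ?_ ?_
        · intro l hl
          simp only [mem_Ico] at hl ⊢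
          omega
        · intro l _ l' _ h
          simpa using h
        · intro l hl
          simp only [mem_Ico] at hl
          exact ⟨l + 1, by simp only [mem_Ico]; omega, by ring⟩
        · intro l _
          rfl
      rw [h2]
      symm
      refine sum_subset (fun l hl => ?_) fun l hl hl' => h0 _ _ _ ?_
      · simp only [mem_Ico] at hl ⊢
        omega
      · simp only [mem_Ico] at hl hl'
        omega
    rw [h1]
    exact sum_Ico_add_sum_Ico_pred fun l hl => h0 _ _ _ (by omega)
  have hleft : ∀ i j, i < -N → a (i, j) = 0 := fun i j hi =>
    sum_eq_zero fun l _ => h0 _ _ _ (by omega)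
  have hright : ∀ i j, N ≤ i → a (i, j) = 0 := fun i j hi =>
    sum_eq_zero fun l _ => h0 _ _ _ (by omega)
  have hbot : ∀ i j, j < -N → a (i, j) = 0 := fun i j hj => by
    simp only [ha]
    rw [Ico_eq_empty (by omega), sum_empty]
  have htop : ∀ i j, N ≤ j → a (i, j) = 0 := by
    intro i j hj
    have hstep : ∀ k : ℕ, a (-N - 1 + k, j) = 0 := by
      intro k
      induction k with
      | zero => exact hleft _ _ (by simp)
      | succ k ih =>
        have h1 := hfalse (-N - 1 + (k + 1 : ℕ)) j
        rw [h0 _ _ _ (by omega)] at h1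
        have h2 : -N - 1 + ((k + 1 : ℕ) : ℤ) - 1 = -N - 1 + k := by push_cast; ring
        rwa [h2, ih, add_zero] at h1
    rcases lt_or_ge i (-N) with hi | hi
    · exact hleft _ _ hi
    · have := hstep (i + N + 1).toNat
      rwa [Int.toNat_of_nonneg (by omega), show -N - 1 + (i + N + 1) = i by ring] at this
  refine ⟨a, ?_, ?_⟩
  · refine (Ico (-N) N ×ˢ Ico (-N) N).finite_toSet.subset ?_
    rintro ⟨i, j⟩ h
    rw [Set.mem_ofPred_eq] at h
    simp only [coe_product, coe_Ico, Set.mem_prod, Set.mem_Ico]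
    by_contra h'
    rcases lt_or_ge i (-N) with h1 | h1
    · exact h (hleft i j h1)
    rcases lt_or_ge j (-N) with h2 | h2
    · exact h (hbot i j h2)
    rcases lt_or_ge i N with h3 | h3
    · exact h (htop i j (by omega))
    · exact h (hright i j h3)
  · ext ⟨_ | _, i, j⟩
    · exact hfalse i j
    · exact htrue i j

end Grid

section GridModel

open Finset GridEdge

/-- The grid edge `e` joins the sets `P` and `Q`. -/
def GridEdge.Joins (e : GridEdge) (P Q : Set (ℤ × ℤ)) : Prop :=
  e.src ∈ P ∧ e.tgt ∈ Q ∨ e.src ∈ Q ∧ e.tgt ∈ P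

lemma GridAdj.symm {p q : ℤ × ℤ} : GridAdj p q → GridAdj q p := fun ⟨e, h⟩ => ⟨e, h.symm⟩

lemma GridEdge.Joins.symm {e : GridEdge} {P Q : Set (ℤ × ℤ)} : e.Joins P Q → e.Joins Q P :=
  Or.symm

lemma GridAdj.exists_joins {p q : ℤ × ℤ} {P Q : Set (ℤ × ℤ)} (h : GridAdj p q) (hp : p ∈ P)
    (hq : q ∈ Q) : ∃ e : GridEdge, e.Joins P Q := by
  obtain ⟨e, ⟨rfl, rfl⟩ | ⟨rfl, rfl⟩⟩ := h
  · exact ⟨e, .inl ⟨hp, hq⟩⟩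
  · exact ⟨e, .inr ⟨hq, hp⟩⟩

/-- A model of `G` as a minor of the integer grid: vertices are represented by disjoint finite
connected sets of grid points, and adjacent vertices by adjacent sets. -/
structure GridModel (G : SimpleGraph V) where
  /-- The grid points representing a vertex. -/
  branch : V → Set (ℤ × ℤ)
  finite_branch : ∀ v, (branch v).Finite
  eq_of_mem : ∀ {u v p}, p ∈ branch u → p ∈ branch v → u = v
  connected : ∀ v, ∃ r ∈ branch v, ∀ p ∈ branch v,
    Relation.ReflTransGen (fun a b => a ∈ branch v ∧ b ∈ branch v ∧ GridAdj a b) r p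
  exists_gridAdj : ∀ {u v}, G.Adj u v → ∃ p ∈ branch u, ∃ q ∈ branch v, GridAdj p q

namespace GridModel

variable {G : SimpleGraph V} (M : GridModel G)

lemma eq_of_joins {e : GridEdge} {a b c d : V} (h : e.Joins (M.branch a) (M.branch b))
    (h' : e.Joins (M.branch c) (M.branch d)) : s(a, b) = s(c, d) := by
  rcases h with ⟨h1, h2⟩ | ⟨h1, h2⟩ <;> rcases h' with ⟨h3, h4⟩ | ⟨h3, h4⟩ <;>
    simp [M.eq_of_mem h1 h3, M.eq_of_mem h2 h4]

lemma exists_edgeMap [Finite V] : ∃ h : Sym2 V → GridEdge,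
    (∀ a b, G.Adj a b → (h s(a, b)).Joins (M.branch a) (M.branch b)) ∧
    ∀ f ∉ G.edgeSet, ∀ v, (h f).src ∉ M.branch v := by
  have hfin : (⋃ v, M.branch v).Finite := Set.finite_iUnion M.finite_branch
  obtain ⟨p, hp⟩ := hfin.exists_notMem
  have : ∀ f : Sym2 V, ∃ e : GridEdge,
      (∀ a b, s(a, b) = f → G.Adj a b → e.Joins (M.branch a) (M.branch b)) ∧
      (f ∉ G.edgeSet → ∀ v, e.src ∉ M.branch v) := by
    intro f
    induction f using Sym2.ind with
    | _ a b =>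
      by_cases hab : G.Adj a b
      · obtain ⟨p, hp, q, hq, hpq⟩ := M.exists_gridAdj hab
        obtain ⟨e, he⟩ := hpq.exists_joins hp hq
        refine ⟨e, fun c d h _ => ?_, fun h => absurd hab h⟩
        rcases Sym2.eq_iff.1 h with ⟨rfl, rfl⟩ | ⟨rfl, rfl⟩
        · exact he
        · exact he.symm
      · refine ⟨(true, p), fun c d h hcd => absurd hcd ?_, fun _ v hv =>
          hp (Set.mem_iUnion_of_mem v hv)⟩
        rwa [← G.mem_edgeSet, h]
  choose h h1 h2 using this
  exact ⟨h, fun a b => h1 _ a b rfl, h2⟩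

/-- A chain of grid edges inside a branch set with prescribed endpoints. -/
lemma exists_path {v : V} {r p : ℤ × ℤ} (h : Relation.ReflTransGen
      (fun a b => a ∈ M.branch v ∧ b ∈ M.branch v ∧ GridAdj a b) r p) :
    ∃ c : GridEdge → ZMod 2, {e | c e ≠ 0}.Finite ∧
      (∀ e, c e ≠ 0 → e.src ∈ M.branch v ∧ e.tgt ∈ M.branch v) ∧
      gridBoundary c = Pi.single r 1 + Pi.single p 1 := by
  induction h with
  | refl => exact ⟨0, by simp, by simp, by rw [map_zero, CharTwo.add_self_eq_zero]⟩
  | @tail p q _ hpq ih =>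
    obtain ⟨c, hfin, hin, hbd⟩ := ih
    obtain ⟨hp, hq, e, he⟩ := hpq
    have hs : ∀ f, (Pi.single e 1 : GridEdge → ZMod 2) f ≠ 0 → f = e := by
      intro f hf
      by_contra h
      exact hf (by simp [h])
    refine ⟨c + Pi.single e 1, ?_, ?_, ?_⟩
    · refine (hfin.union (Set.finite_singleton e)).subset fun f hf => ?_
      by_contra h
      simp only [Set.mem_union, Set.mem_ofPred_eq, Set.mem_singleton_iff, not_or, not_not] at h
      exact hf (by simp [h.1, h.2])
    · intro f hf
      by_cases hcf : c f = 0
      · rw [hs f (by simpa [hcf] using hf)]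
        rcases he with ⟨rfl, rfl⟩ | ⟨rfl, rfl⟩
        · exact ⟨hp, hq⟩
        · exact ⟨hq, hp⟩
      · exact hin f hcf
    · rw [map_add, hbd, gridBoundary_single]
      have : (Pi.single e.src 1 + Pi.single e.tgt 1 : ℤ × ℤ → ZMod 2) =
          Pi.single p 1 + Pi.single q 1 := by
        rcases he with ⟨rfl, rfl⟩ | ⟨rfl, rfl⟩
        · rfl
        · rw [add_comm]
      rw [this, add_assoc, ← add_assoc (Pi.single p 1), CharTwo.add_self_eq_zero, zero_add]

/-- Grid edges inside branch sets, together with those chosen by `h` for the edges of `G`. -/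
def used (h : Sym2 V → GridEdge) : Set GridEdge :=
  {e | (∃ v, e.src ∈ M.branch v ∧ e.tgt ∈ M.branch v) ∨ ∃ f ∈ G.edgeSet, h f = e}

lemma edgeMap_inj {h : Sym2 V → GridEdge}
    (hj : ∀ a b, G.Adj a b → (h s(a, b)).Joins (M.branch a) (M.branch b)) {f g : Sym2 V}
    (hf : f ∈ G.edgeSet) (hg : g ∈ G.edgeSet) (hfg : h f = h g) : f = g := by
  induction f using Sym2.ind with
  | _ a b =>
    induction g using Sym2.ind with
    | _ c d => exact M.eq_of_joins (hj a b hf) (hfg ▸ hj c d hg)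

lemma edgeMap_not_inner {h : Sym2 V → GridEdge}
    (hj : ∀ a b, G.Adj a b → (h s(a, b)).Joins (M.branch a) (M.branch b)) {f : Sym2 V}
    (hf : f ∈ G.edgeSet) (v : V) :
    ¬ ((h f).src ∈ M.branch v ∧ (h f).tgt ∈ M.branch v) := by
  induction f using Sym2.ind with
  | _ a b =>
    intro hv
    have := M.eq_of_joins (hj a b hf) (.inl hv)
    have hab : G.Adj a b := hf
    rcases Sym2.eq_iff.1 this with ⟨rfl, rfl⟩ | ⟨rfl, rfl⟩ <;> exact hab.ne rfl

/-- Lift of an edge of `G` to a chain of grid edges. -/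
lemma exists_lift_single [Fintype V] [DecidableEq V] {h : Sym2 V → GridEdge}
    (hj : ∀ a b, G.Adj a b → (h s(a, b)).Joins (M.branch a) (M.branch b))
    {r : V → ℤ × ℤ} (hr : ∀ v, ∀ p ∈ M.branch v,
      Relation.ReflTransGen (fun a b => a ∈ M.branch v ∧ b ∈ M.branch v ∧ GridAdj a b) (r v) p)
    {f : Sym2 V} (hf : f ∈ G.edgeSet) :
    ∃ c : GridEdge → ZMod 2, {e | c e ≠ 0}.Finite ∧ (∀ e, c e ≠ 0 → e ∈ M.used h) ∧
      (∀ g ∈ G.edgeSet, c (h g) = (Pi.single f 1 : Sym2 V → ZMod 2) g) ∧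
      gridBoundary c =
        ∑ v, SimpleGraph.boundaryTwo (Pi.single f 1) v • Pi.single (r v) 1 := by
  induction f using Sym2.ind with
  | _ a b =>
  have hab : G.Adj a b := hf
  obtain ⟨p, q, hp, hq, hpq⟩ : ∃ p q, p ∈ M.branch a ∧ q ∈ M.branch b ∧
      (Pi.single (h s(a, b)).src 1 + Pi.single (h s(a, b)).tgt 1 : ℤ × ℤ → ZMod 2) =
        Pi.single p 1 + Pi.single q 1 := by
    rcases hj a b hab with ⟨h1, h2⟩ | ⟨h1, h2⟩
    · exact ⟨_, _, h1, h2, rfl⟩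
    · exact ⟨_, _, h2, h1, add_comm _ _⟩
  obtain ⟨c, hc, hcin, hcb⟩ := M.exists_path (hr a p hp)
  obtain ⟨d, hd, hdin, hdb⟩ := M.exists_path (hr b q hq)
  refine ⟨Pi.single (h s(a, b)) 1 + (c + d), ?_, ?_, ?_, ?_⟩
  · refine ((Set.finite_singleton (h s(a, b))).union (hc.union hd)).subset fun e he => ?_
    by_contra hcon
    simp only [Set.mem_union, Set.mem_ofPred_eq, Set.mem_singleton_iff, not_or, not_not] at hcon
    exact he (by simp [hcon.1, hcon.2.1, hcon.2.2])
  · intro e he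
    by_cases h1 : c e = 0
    · by_cases h2 : d e = 0
      · refine .inr ⟨s(a, b), hf, ?_⟩
        by_contra h3
        exact he (by simp [h1, h2, Ne.symm h3])
      · exact .inl ⟨b, hdin e h2⟩
    · exact .inl ⟨a, hcin e h1⟩
  · intro g hg
    have h1 : c (h g) = 0 := by
      by_contra h1
      exact M.edgeMap_not_inner hj hg a (hcin _ h1)
    have h2 : d (h g) = 0 := by
      by_contra h2
      exact M.edgeMap_not_inner hj hg b (hdin _ h2)
    have h3 : h g = h s(a, b) ↔ g = s(a, b) :=
      ⟨fun h3 => M.edgeMap_inj hj hg hf h3, fun h3 => by rw [h3]⟩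
    simp only [Pi.add_apply, h1, h2, Pi.single_apply, h3, add_zero]
  · rw [map_add, map_add, hcb, hdb, gridBoundary_single, hpq, SimpleGraph.boundaryTwo_single hab.ne]
    simp only [Pi.add_apply, add_smul, sum_add_distrib, Pi.single_apply, ite_smul, one_smul,
      zero_smul, sum_ite_eq', mem_univ, if_true]
    have h2 : ∀ x : ℤ × ℤ → ZMod 2, x + x = 0 := CharTwo.add_self_eq_zero
    linear_combination h2 (Pi.single p 1) + h2 (Pi.single q 1)

/-- Every cycle of `G` comes from a finitely supported cycle of the grid. -/
lemma exists_lift [Fintype V] {h : Sym2 V → GridEdge}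
    (hj : ∀ a b, G.Adj a b → (h s(a, b)).Joins (M.branch a) (M.branch b))
    (hn : ∀ f ∉ G.edgeSet, ∀ v, (h f).src ∉ M.branch v) {z : Sym2 V → ZMod 2}
    (hz : z ∈ G.cycleSpace) :
    ∃ c : GridEdge → ZMod 2, {e | c e ≠ 0}.Finite ∧ c ∈ vanishOn (M.used h)ᶜ ∧
      c ∘ h = z ∧ gridBoundary c = 0 := by
  classical
  choose r _ hr using M.connected
  have : ∀ f : Sym2 V, ∃ c : GridEdge → ZMod 2, {e | c e ≠ 0}.Finite ∧
      (∀ e, c e ≠ 0 → e ∈ M.used h) ∧ (f ∈ G.edgeSet →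
        (∀ g ∈ G.edgeSet, c (h g) = (Pi.single f 1 : Sym2 V → ZMod 2) g) ∧
        gridBoundary c =
          ∑ v, SimpleGraph.boundaryTwo (Pi.single f 1) v • Pi.single (r v) 1) := by
    intro f
    by_cases hf : f ∈ G.edgeSet
    · obtain ⟨c, h1, h2, h3, h4⟩ := M.exists_lift_single hj hr hf
      exact ⟨c, h1, h2, fun _ => ⟨h3, h4⟩⟩
    · exact ⟨0, by simp, by simp, fun h => absurd h hf⟩
  choose L hfin hused hL using this
  have hz0 := (SimpleGraph.mem_cycleSpace.1 hz).1
  have hzsum : z = ∑ f, z f • Pi.single f 1 := by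
    ext g
    simp [Finset.sum_apply, Pi.single_apply]
  have hvan : ∑ f, z f • L f ∈ vanishOn (M.used h)ᶜ := by
    refine sum_mem fun f _ => Submodule.smul_mem _ _ fun e he => ?_
    by_contra h0
    exact he (hused f e h0)
  refine ⟨∑ f, z f • L f, ?_, hvan, ?_, ?_⟩
  · refine (Set.finite_iUnion hfin).subset fun e he => ?_
    by_contra hcon
    simp only [Set.mem_iUnion, Set.mem_ofPred_eq, not_exists, not_not] at hcon
    exact he (by simp [Finset.sum_apply, hcon])
  · ext g
    by_cases hg : g ∈ G.edgeSet
    · conv_rhs => rw [hzsum]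
      simp only [Function.comp_apply, Finset.sum_apply, Pi.smul_apply]
      refine sum_congr rfl fun f _ => ?_
      by_cases hf : f ∈ G.edgeSet
      · rw [(hL f hf).1 g hg]
      · rw [hz0 f hf, zero_smul, zero_smul]
    · rw [hz0 g hg]
      refine hvan _ ?_
      rintro (⟨v, hv, -⟩ | ⟨f, hf, hfg⟩)
      · exact hn g hg v hv
      · induction f using Sym2.ind with
        | _ a b =>
          rcases hfg ▸ hj a b hf with hab | hab
          · exact hn g hg _ hab.1
          · exact hn g hg _ hab.1
  · have hterm : ∀ f, z f • gridBoundary (L f) =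
        ∑ v, (z f • SimpleGraph.boundaryTwo (Pi.single f 1) v) • Pi.single (r v) 1 := by
      intro f
      by_cases hf : f ∈ G.edgeSet
      · rw [(hL f hf).2, smul_sum]
        simp only [smul_assoc]
      · simp [hz0 f hf]
    have hb : SimpleGraph.boundaryTwo z = 0 := hz.2
    rw [map_sum]
    simp only [map_smul]
    rw [sum_congr rfl fun f _ => hterm f, sum_comm]
    refine sum_eq_zero fun v _ => ?_
    rw [← sum_smul]
    have : ∑ f, z f • SimpleGraph.boundaryTwo (Pi.single f 1) v = SimpleGraph.boundaryTwo z v := by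
      conv_rhs => rw [hzsum]
      simp [map_sum, Finset.sum_apply]
    rw [this, hb, Pi.zero_apply, zero_smul]

/-- Sums of grid squares supported on used edges project to cycles of `G`. -/
lemma comp_mem_cycleSpace [Fintype V] {h : Sym2 V → GridEdge}
    (hj : ∀ a b, G.Adj a b → (h s(a, b)).Joins (M.branch a) (M.branch b))
    (hn : ∀ f ∉ G.edgeSet, ∀ v, (h f).src ∉ M.branch v) {W : Finset (ℤ × ℤ)}
    {c : GridEdge → ZMod 2}
    (hc : c ∈ Submodule.span (ZMod 2) (Set.range fun p : W => gridSquares (Pi.single p.1 1)))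
    (hv : c ∈ vanishOn (M.used h)ᶜ) : c ∘ h ∈ G.cycleSpace := by
  classical
  have h0 : ∀ f, f ∉ G.edgeSet → c (h f) = 0 := by
    intro g hg
    refine hv _ ?_
    rintro (⟨v, hv, -⟩ | ⟨f, hf, hfg⟩)
    · exact hn g hg v hv
    · induction f using Sym2.ind with
      | _ a b =>
        rcases hfg ▸ hj a b hf with hab | hab
        · exact hn g hg _ hab.1
        · exact hn g hg _ hab.1
  refine SimpleGraph.mem_cycleSpace.2 ⟨h0, fun v => ?_⟩
  set X : Finset GridEdge := univ.image h ∪ W.biUnion fun p =>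
    {(true, p.1, p.2), (true, p.1, p.2 + 1), (false, p.1, p.2), (false, p.1 + 1, p.2)} with hX
  set χ : ℤ × ℤ → ZMod 2 := fun p => if p ∈ M.branch v then 1 else 0 with hχ
  set Λ : (GridEdge → ZMod 2) →ₗ[ZMod 2] ZMod 2 :=
    ∑ e ∈ X, (χ e.src + χ e.tgt) • LinearMap.proj e with hΛ
  have hΛa : ∀ d, Λ d = ∑ e ∈ X, (χ e.src + χ e.tgt) * d e := by
    intro d
    simp [hΛ]
  have hΛs : ∀ e ∈ X, Λ (Pi.single e 1) = χ e.src + χ e.tgt := by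
    intro e he
    rw [hΛa]
    simp [Pi.single_apply, he]
  have hΛ0 : Λ c = 0 := by
    refine (Submodule.span_le (p := LinearMap.ker Λ)).2 ?_ hc
    rintro _ ⟨⟨⟨i, j⟩, hp⟩, rfl⟩
    have hmem : ∀ e ∈ ({(true, i, j), (true, i, j + 1), (false, i, j), (false, i + 1, j)} :
        Finset GridEdge), e ∈ X := fun e he =>
      mem_union_right _ (mem_biUnion.2 ⟨(i, j), hp, he⟩)
    simp only [SetLike.mem_coe, LinearMap.mem_ker]
    rw [gridSquares_single, map_add, map_add, map_add, hΛs _ (hmem _ (by simp)),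
      hΛs _ (hmem _ (by simp)), hΛs _ (hmem _ (by simp)), hΛs _ (hmem _ (by simp))]
    simp only [src, tgt]
    generalize χ (i, j) = x1
    generalize χ (i + 1, j) = x2
    generalize χ (i, j + 1) = x3
    generalize χ (i + 1, j + 1) = x4
    revert x1 x2 x3 x4
    decide
  rw [← hΛ0, hΛa]
  have hsub : ∑ w, (c ∘ h) s(v, w) = ∑ w with G.Adj v w, (c ∘ h) s(v, w) := by
    rw [sum_filter]
    refine sum_congr rfl fun w _ => ?_
    split_ifs with hw
    · rfl
    · exact h0 _ hw
  rw [hsub]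
  refine sum_of_injOn (fun w => h s(v, w)) ?_ ?_ ?_ ?_
  · intro w hw w' hw' hww
    simp only [coe_filter, mem_univ, true_and, Set.mem_ofPred_eq] at hw hw'
    exact Sym2.congr_right.1 (M.edgeMap_inj hj (f := s(v, w)) (g := s(v, w')) hw hw' hww)
  · intro w _
    exact mem_union_left _ (mem_image_of_mem _ (mem_univ _))
  · intro e _ he
    by_cases hce : c e = 0
    · rw [hce, mul_zero]
    have hcoef : χ e.src = χ e.tgt := by
      have hu : e ∈ M.used h := by
        by_contra hu
        exact hce (hv e hu)
      rcases hu with ⟨u, hu1, hu2⟩ | ⟨f, hf, rfl⟩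
      · by_cases huv : u = v
        · subst huv
          simp [hχ, hu1, hu2]
        · have h1 : e.src ∉ M.branch v := fun h1 => huv (M.eq_of_mem hu1 h1)
          have h2 : e.tgt ∉ M.branch v := fun h1 => huv (M.eq_of_mem hu2 h1)
          simp [hχ, h1, h2]
      · induction f using Sym2.ind with
        | _ a b =>
          have hab : G.Adj a b := hf
          have ha : a ≠ v := by
            rintro rfl
            exact he ⟨b, by simpa using hab, rfl⟩
          have hb : b ≠ v := by
            rintro rfl
            exact he ⟨a, by simpa using hab.symm, by rw [Sym2.eq_swap]⟩
          have key : ∀ p, p ∈ M.branch a ∨ p ∈ M.branch b → χ p = 0 := by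
            rintro p (hp | hp)
            · exact if_neg fun h1 => ha (M.eq_of_mem hp h1)
            · exact if_neg fun h1 => hb (M.eq_of_mem hp h1)
          rcases hj a b hab with ⟨h1, h2⟩ | ⟨h1, h2⟩
          · rw [key _ (.inl h1), key _ (.inr h2)]
          · rw [key _ (.inr h1), key _ (.inl h2)]
    rw [hcoef, CharTwo.add_self_eq_zero, zero_mul]
  · intro w hw
    have hw : G.Adj v w := by simpa using hw
    have hnot : ∀ p ∈ M.branch w, χ p = 0 := fun p hp =>
      if_neg fun h1 => hw.ne (M.eq_of_mem h1 hp)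
    have hyes : ∀ p ∈ M.branch v, χ p = 1 := fun p hp => if_pos hp
    rcases hj v w hw with ⟨h1, h2⟩ | ⟨h1, h2⟩
    · rw [hyes _ h1, hnot _ h2, add_zero, one_mul, Function.comp_apply]
    · rw [hyes _ h2, hnot _ h1, zero_add, one_mul, Function.comp_apply]

theorem isMacLane [Fintype V] (M : GridModel G) : G.IsMacLane := by
  classical
  obtain ⟨h, hj, hn⟩ := M.exists_edgeMap
  have hlift : ∀ z : G.cycleSpace, ∃ a : ℤ × ℤ → ZMod 2, {p | a p ≠ 0}.Finite ∧
      gridSquares a ∈ vanishOn (M.used h)ᶜ ∧ gridSquares a ∘ h = z.1 := by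
    intro z
    obtain ⟨c, hfin, hvan, hcz, hb⟩ := M.exists_lift hj hn z.2
    obtain ⟨a, ha, rfl⟩ := exists_gridSquares_eq hfin hb
    exact ⟨a, ha, hvan, hcz⟩
  choose a hfin hvan haz using hlift
  have hW : (⋃ z, {p | a z p ≠ 0}).Finite := Set.finite_iUnion hfin
  set W := hW.toFinset with hWdef
  obtain ⟨b, hb, hspan, -⟩ := (isSparse_gridSquares W).exists_vanishOn (M.used h)ᶜ
  refine ⟨W, inferInstance, fun i => b i ∘ h, hb.comp_right h, ?_⟩
  rw [span_range_comp_right, hspan]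
  ext z
  simp only [Submodule.mem_map, Submodule.mem_inf]
  constructor
  · rintro ⟨c, ⟨hc, hv⟩, rfl⟩
    exact M.comp_mem_cycleSpace hj hn hc hv
  · intro hz
    refine ⟨gridSquares (a ⟨z, hz⟩), ⟨gridSquares_mem_span fun p hp => ?_, hvan _⟩, haz _⟩
    rw [hWdef, Set.Finite.mem_toFinset]
    exact Set.mem_iUnion_of_mem _ hp

end GridModel

end GridModel

section GridCells

open Relation

/-- Connectedness of a set of grid points. -/
def GridConnected (P : Set (ℤ × ℤ)) : Prop :=
  ∀ p ∈ P, ∀ q ∈ P, ReflTransGen (fun a b => a ∈ P ∧ b ∈ P ∧ GridAdj a b) p q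

/-- A graph has a grid model as soon as vertices and edges are represented by connected sets of
grid points which meet only when they are incident. -/
theorem GridModel.nonempty_of_incidence {G : SimpleGraph V} {ι : Type*} [Finite ι]
    {tail head : ι → V} {S : V → Set (ℤ × ℤ)} {R : ι → Set (ℤ × ℤ)}
    (hG : ∀ u v, G.Adj u v → ∃ i, tail i = u ∧ head i = v ∨ tail i = v ∧ head i = u)
    (hSfin : ∀ v, (S v).Finite) (hRfin : ∀ i, (R i).Finite) (hSne : ∀ v, (S v).Nonempty)
    (hS : ∀ v, GridConnected (S v)) (hR : ∀ i, GridConnected (R i))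
    (hSS : ∀ u v, u ≠ v → Disjoint (S u) (S v)) (hRR : ∀ i j, i ≠ j → Disjoint (R i) (R j))
    (hRS : ∀ i v, v ≠ tail i → v ≠ head i → Disjoint (R i) (S v))
    (htail : ∀ i, (R i ∩ S (tail i)).Nonempty) (hhead : ∀ i, (R i ∩ S (head i)).Nonempty)
    (hne : ∀ i, tail i ≠ head i) : Nonempty (GridModel G) := by
  simp only [Set.disjoint_left] at hSS hRR hRS
  set rel : ι → ℤ × ℤ → ℤ × ℤ → Prop := fun i a b =>
    a ∈ R i \ S (head i) ∧ b ∈ R i \ S (head i) ∧ GridAdj a b with hrel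
  set K : ι → Set (ℤ × ℤ) := fun i =>
    {p | p ∈ R i \ S (head i) ∧ ∃ a ∈ R i ∩ S (tail i), ReflTransGen (rel i) a p} with hK
  set T : V → Set (ℤ × ℤ) := fun v => S v ∪ ⋃ i, ⋃ _ : tail i = v, K i with hT
  have memT : ∀ {v p}, p ∈ T v ↔ p ∈ S v ∨ ∃ i, tail i = v ∧ p ∈ K i := by
    intro v p
    simp [hT]
  have hadj : ∀ i, ∃ p ∈ K i, ∃ q ∈ S (head i), GridAdj p q := by
    intro i
    obtain ⟨a, ha⟩ := htail i
    obtain ⟨b, hb⟩ := hhead i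
    have haK : a ∈ K i := ⟨⟨ha.1, hSS _ _ (hne i) ha.2⟩, a, ha, .refl⟩
    have key : ∀ p, ReflTransGen (fun a b => a ∈ R i ∧ b ∈ R i ∧ GridAdj a b) a p →
        p ∈ K i ∨ ∃ p ∈ K i, ∃ q ∈ S (head i), GridAdj p q := by
      intro p hp
      induction hp with
      | refl => exact .inl haK
      | @tail p q _ hpq ih =>
        rcases ih with ih | ih
        · by_cases hq : q ∈ S (head i)
          · exact .inr ⟨p, ih, q, hq, hpq.2.2⟩
          · obtain ⟨hp, c, hc, hcp⟩ := ih
            exact .inl ⟨⟨hpq.2.1, hq⟩, c, hc, hcp.tail ⟨hp, ⟨hpq.2.1, hq⟩, hpq.2.2⟩⟩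
        · exact .inr ih
    exact (key b (hR i a ha.1 b hb.1)).resolve_left fun h => h.1.2 hb.2
  have hSK : ∀ {u i p}, p ∈ S u → p ∈ K i → u = tail i := by
    intro u i p hp hpK
    by_contra hu
    by_cases hu' : u = head i
    · exact hpK.1.2 (hu' ▸ hp)
    · exact hRS i u hu hu' hpK.1.1 hp
  refine ⟨⟨T, fun v => ?_, ?_, fun v => ?_, ?_⟩⟩
  · exact (hSfin v).union (Set.finite_iUnion fun i => Set.finite_iUnion fun _ =>
      (hRfin i).subset fun p hp => hp.1.1)
  · intro u v p hu hv
    rcases memT.1 hu with hu | ⟨i, rfl, hi⟩ <;> rcases memT.1 hv with hv | ⟨j, rfl, hj⟩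
    · by_contra huv
      exact hSS u v huv hu hv
    · exact hSK hu hj
    · exact (hSK hv hi).symm
    · by_contra hij
      exact hRR i j (fun h => hij (by rw [h])) hi.1.1 hj.1.1
  · obtain ⟨r, hr⟩ := hSne v
    have hreach : ∀ p ∈ S v, ReflTransGen (fun a b => a ∈ T v ∧ b ∈ T v ∧ GridAdj a b) r p :=
      fun p hp => ReflTransGen.mono (fun a b hab => ⟨.inl hab.1, .inl hab.2.1, hab.2.2⟩) _ _
        (hS v r hr p hp)
    refine ⟨r, .inl hr, fun p hp => ?_⟩
    rcases memT.1 hp with hp | ⟨i, rfl, -, a, ha, hap⟩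
    · exact hreach p hp
    · suffices h : p ∈ K i ∧
          ReflTransGen (fun a b => a ∈ T (tail i) ∧ b ∈ T (tail i) ∧ GridAdj a b) r p from h.2
      induction hap with
      | refl => exact ⟨⟨⟨ha.1, hSS _ _ (hne i) ha.2⟩, a, ha, .refl⟩, hreach a ha.2⟩
      | @tail p q hap hpq ih =>
        have hq : q ∈ K i := ⟨hpq.2.1, a, ha, hap.tail hpq⟩
        have hp' : p ∈ K i := ⟨hpq.1, a, ha, hap⟩
        have hpT : p ∈ T (tail i) := memT.2 (.inr ⟨i, rfl, hp'⟩)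
        exact ⟨hq, (ih hpT).2.tail ⟨hpT, memT.2 (.inr ⟨i, rfl, hq⟩), hpq.2.2⟩⟩
  · intro u v huv
    obtain ⟨i, ⟨rfl, rfl⟩ | ⟨rfl, rfl⟩⟩ := hG u v huv
    · obtain ⟨p, hp, q, hq, hpq⟩ := hadj i
      exact ⟨p, memT.2 (.inr ⟨i, rfl, hp⟩), q, .inl hq, hpq⟩
    · obtain ⟨p, hp, q, hq, hpq⟩ := hadj i
      exact ⟨q, .inl hq, p, memT.2 (.inr ⟨i, rfl, hp⟩), hpq.symm⟩

/-- The closed grid cell of side length `s` with lower left corner `s • p`. -/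
def gridCell (s : ℝ) (p : ℤ × ℤ) : Set (ℝ × ℝ) :=
  Set.Icc (p.1 * s) ((p.1 + 1) * s) ×ˢ Set.Icc (p.2 * s) ((p.2 + 1) * s)

/-- The grid cells meeting a subset of the plane. -/
def cellsMeeting (s : ℝ) (A : Set (ℝ × ℝ)) : Set (ℤ × ℤ) := {p | (gridCell s p ∩ A).Nonempty}

lemma isClosed_gridCell (s : ℝ) (p : ℤ × ℤ) : IsClosed (gridCell s p) :=
  isClosed_Icc.prod isClosed_Icc

lemma exists_mem_gridCell {s : ℝ} (hs : 0 < s) (x : ℝ × ℝ) : ∃ p, x ∈ gridCell s p := by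
  have key : ∀ y : ℝ, y ∈ Set.Icc (⌊y / s⌋ * s) ((⌊y / s⌋ + 1) * s) := fun y =>
    ⟨(le_div_iff₀ hs).1 (Int.floor_le _), (div_le_iff₀ hs).1 (Int.lt_floor_add_one _).le⟩
  exact ⟨(⌊x.1 / s⌋, ⌊x.2 / s⌋), key _, key _⟩

lemma dist_le_of_mem_gridCell {s : ℝ} {p : ℤ × ℤ} {x y : ℝ × ℝ} (hx : x ∈ gridCell s p)
    (hy : y ∈ gridCell s p) : dist x y ≤ s := by
  obtain ⟨⟨h1, h2⟩, h3, h4⟩ := hx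
  obtain ⟨⟨h5, h6⟩, h7, h8⟩ := hy
  rw [Prod.dist_eq, max_le_iff, Real.dist_eq, Real.dist_eq, abs_le, abs_le]
  refine ⟨⟨?_, ?_⟩, ?_, ?_⟩ <;> linarith

lemma cellsMeeting_nonempty {s : ℝ} (hs : 0 < s) {A : Set (ℝ × ℝ)} (hA : A.Nonempty) :
    (cellsMeeting s A).Nonempty := by
  obtain ⟨x, hx⟩ := hA
  obtain ⟨p, hp⟩ := exists_mem_gridCell hs x
  exact ⟨p, x, hp, hx⟩

lemma finite_cellsMeeting {s : ℝ} (hs : 0 < s) {A : Set (ℝ × ℝ)} (hA : Bornology.IsBounded A) :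
    (cellsMeeting s A).Finite := by
  obtain ⟨B, hB⟩ := hA.exists_norm_le
  refine ((Set.finite_Icc ⌊-B / s - 1⌋ ⌈B / s⌉).prod
    (Set.finite_Icc ⌊-B / s - 1⌋ ⌈B / s⌉)).subset ?_
  rintro ⟨i, j⟩ ⟨x, ⟨⟨h1, h2⟩, h3, h4⟩, hx⟩
  have hxB := hB x hx
  rw [Prod.norm_def, max_le_iff, Real.norm_eq_abs, Real.norm_eq_abs, abs_le, abs_le] at hxB
  have key : ∀ (i : ℤ) (y : ℝ), i * s ≤ y → y ≤ (i + 1) * s → -B ≤ y → y ≤ B →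
      i ∈ Set.Icc ⌊-B / s - 1⌋ ⌈B / s⌉ := by
    intro i y h1 h2 h3 h4
    constructor
    · have : -B / s ≤ i + 1 := (div_le_iff₀ hs).2 (h3.trans h2)
      exact_mod_cast (Int.floor_le (-B / s - 1)).trans (by linarith : -B / s - 1 ≤ (i : ℝ))
    · exact_mod_cast ((le_div_iff₀ hs).2 (h1.trans h4)).trans (Int.le_ceil (B / s))
  exact ⟨key i x.1 h1 h2 hxB.1.1 hxB.1.2, key j x.2 h3 h4 hxB.2.1 hxB.2.2⟩

lemma abs_sub_le_one_of_mem_Icc {s : ℝ} (hs : 0 < s) {i j : ℤ} {y : ℝ}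
    (hi : y ∈ Set.Icc (i * s) ((i + 1) * s)) (hj : y ∈ Set.Icc (j * s) ((j + 1) * s)) :
    i = j ∨ i + 1 = j ∨ j + 1 = i := by
  have h1 : (i : ℝ) ≤ j + 1 := le_of_mul_le_mul_right (hi.1.trans hj.2) hs
  have h2 : (j : ℝ) ≤ i + 1 := le_of_mul_le_mul_right (hj.1.trans hi.2) hs
  norm_cast at h1 h2
  omega

lemma gridConnected_cellsMeeting {s : ℝ} (hs : 0 < s) {A : Set (ℝ × ℝ)}
    (hA : Bornology.IsBounded A) (hc : IsPreconnected A) : GridConnected (cellsMeeting s A) := by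
  intro p hp q hq
  by_contra hpq
  set rel : ℤ × ℤ → ℤ × ℤ → Prop := fun a b =>
    a ∈ cellsMeeting s A ∧ b ∈ cellsMeeting s A ∧ GridAdj a b with hrel
  have hfin := finite_cellsMeeting hs hA
  set C : Set (ℤ × ℤ) := {a | a ∈ cellsMeeting s A ∧ ReflTransGen rel p a} with hC
  set D : Set (ℤ × ℤ) := {a | a ∈ cellsMeeting s A ∧ ¬ ReflTransGen rel p a} with hD
  have hclosed : ∀ P ⊆ cellsMeeting s A, IsClosed (⋃ a ∈ P, gridCell s a) := fun P hP =>
    (hfin.subset hP).isClosed_biUnion fun a _ => isClosed_gridCell s a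
  have hmeet : ∀ P : Set (ℤ × ℤ), P ⊆ cellsMeeting s A → P.Nonempty →
      (A ∩ ⋃ a ∈ P, gridCell s a).Nonempty := by
    rintro P hP ⟨a, ha⟩
    obtain ⟨x, hx, hxA⟩ := hP ha
    exact ⟨x, hxA, Set.mem_biUnion ha hx⟩
  have hCs : C ⊆ cellsMeeting s A := fun a ha => ha.1
  have hDs : D ⊆ cellsMeeting s A := fun a ha => ha.1
  obtain ⟨x, hxA, hxC, hxD⟩ := isPreconnected_closed_iff.1 hc _ _ (hclosed C hCs) (hclosed D hDs)
    (fun x hx => by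
      obtain ⟨a, ha⟩ := exists_mem_gridCell hs x
      have haA : a ∈ cellsMeeting s A := ⟨x, ha, hx⟩
      by_cases h : ReflTransGen rel p a
      · exact .inl (Set.mem_biUnion (show a ∈ C from ⟨haA, h⟩) ha)
      · exact .inr (Set.mem_biUnion (show a ∈ D from ⟨haA, h⟩) ha))
    (hmeet C hCs ⟨p, hp, .refl⟩) (hmeet D hDs ⟨q, hq, hpq⟩)
  simp only [Set.mem_iUnion, exists_prop] at hxC hxD
  obtain ⟨⟨i, j⟩, ⟨haA, ha⟩, hxa⟩ := hxC
  obtain ⟨⟨k, l⟩, ⟨hbA, hb⟩, hxb⟩ := hxD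
  have hmid : (k, j) ∈ cellsMeeting s A := ⟨x, ⟨hxb.1, hxa.2⟩, hxA⟩
  refine hb ?_
  have h1 : ReflTransGen rel p (k, j) := by
    rcases abs_sub_le_one_of_mem_Icc hs hxa.1 hxb.1 with h | h | h
    · simp only at h
      rwa [← h]
    · exact ha.tail ⟨haA, hmid, (true, i, j), .inl ⟨rfl, by simpa [GridEdge.tgt] using h⟩⟩
    · exact ha.tail ⟨haA, hmid, (true, k, j), .inr ⟨rfl, by simpa [GridEdge.tgt] using h⟩⟩
  rcases abs_sub_le_one_of_mem_Icc hs hxa.2 hxb.2 with h | h | h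
  · simp only at h
    rwa [← h]
  · exact h1.tail ⟨hmid, hbA, (false, k, j), .inl ⟨rfl, by simpa [GridEdge.tgt] using h⟩⟩
  · exact h1.tail ⟨hmid, hbA, (false, k, l), .inr ⟨rfl, by simpa [GridEdge.tgt] using h⟩⟩

open Filter Topology in
lemma eventually_disjoint_cellsMeeting {A B : Set (ℝ × ℝ)} (hA : IsCompact A) (hB : IsClosed B)
    (hAB : Disjoint A B) :
    ∀ᶠ s in 𝓝[>] (0 : ℝ), Disjoint (cellsMeeting s A) (cellsMeeting s B) := by
  obtain ⟨δ, hδ, h⟩ := Metric.exists_pos_forall_lt_edist hA hB hAB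
  filter_upwards [Ioo_mem_nhdsGT (show (0 : ℝ) < δ from hδ)] with s hs
  rw [Set.disjoint_left]
  rintro p ⟨x, hx, hxA⟩ ⟨y, hy, hyB⟩
  have h1 := h x hxA y hyB
  rw [edist_dist, ← ENNReal.ofReal_coe_nnreal,
    ENNReal.ofReal_lt_ofReal_iff_of_nonneg δ.coe_nonneg] at h1
  linarith [hs.2, dist_le_of_mem_gridCell hx hy]

end GridCells

section Planar

open Filter Topology Set

lemma eventually_disjoint_closedBall {X : Type*} [PseudoMetricSpace X] {x : X} {K : Set X}
    (hK : IsClosed K) (hx : x ∉ K) : ∀ᶠ r in 𝓝[>] (0 : ℝ), Disjoint K (Metric.closedBall x r) := by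
  obtain ⟨ε, hε, h⟩ := Metric.isOpen_iff.1 hK.isOpen_compl x hx
  filter_upwards [Ioo_mem_nhdsGT hε] with r hr
  exact (Set.disjoint_right.2 fun y hy => h (Metric.closedBall_subset_ball hr.2 hy))

lemma eventually_disjoint_closedBall_closedBall {X : Type*} [MetricSpace X] {x y : X}
    (hxy : x ≠ y) :
    ∀ᶠ r in 𝓝[>] (0 : ℝ), Disjoint (Metric.closedBall x r) (Metric.closedBall y r) := by
  have hd := dist_pos.2 hxy
  filter_upwards [Ioo_mem_nhdsGT (half_pos hd)] with r hr
  exact Metric.closedBall_disjoint_closedBall (by linarith [hr.2])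

/-- The interior of an arc contains a subarc meeting given neighbourhoods of both ends. -/
lemma exists_subarc {X : Type*} [TopologicalSpace X] {γ : ℝ → X}
    (hγ : ContinuousOn γ (Icc 0 1)) {P Q : Set X} (hP : P ∈ 𝓝 (γ 0)) (hQ : Q ∈ 𝓝 (γ 1)) :
    ∃ A : Set X, IsCompact A ∧ IsPreconnected A ∧ A ⊆ γ '' Ioo 0 1 ∧
      (A ∩ P).Nonempty ∧ (A ∩ Q).Nonempty := by
  have h0 : ∀ᶠ t in 𝓝[>] (0 : ℝ), γ t ∈ P := by
    have h := (hγ 0 (by simp)).mono Ioo_subset_Icc_self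
    rw [ContinuousWithinAt, nhdsWithin_Ioo_eq_nhdsGT one_pos] at h
    exact h hP
  have h1 : ∀ᶠ t in 𝓝[<] (1 : ℝ), γ t ∈ Q := by
    have h := (hγ 1 (by simp)).mono Ioo_subset_Icc_self
    rw [ContinuousWithinAt, nhdsWithin_Ioo_eq_nhdsLT one_pos] at h
    exact h hQ
  obtain ⟨a, haP, ha⟩ := (h0.and (Ioo_mem_nhdsGT (show (0 : ℝ) < 1 / 2 by norm_num))).exists
  obtain ⟨b, hbQ, hb⟩ := (h1.and (Ioo_mem_nhdsLT (show (1 / 2 : ℝ) < 1 by norm_num))).exists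
  have hab : a ≤ b := (ha.2.trans hb.1).le
  have hsub : Icc a b ⊆ Ioo 0 1 := Icc_subset_Ioo ha.1 hb.2
  have hc : ContinuousOn γ (Icc a b) := hγ.mono (hsub.trans Ioo_subset_Icc_self)
  exact ⟨γ '' Icc a b, isCompact_Icc.image_of_continuousOn hc, isPreconnected_Icc.image γ hc,
    image_mono hsub, ⟨γ a, mem_image_of_mem γ (left_mem_Icc.2 hab), haP⟩,
    ⟨γ b, mem_image_of_mem γ (right_mem_Icc.2 hab), hbQ⟩⟩

lemma GraphEmbeddingIn.vertexPos_notMem {X : Type*} [TopologicalSpace X] {G : SimpleGraph V}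
    (φ : GraphEmbeddingIn X G) {u v w : V} (h : G.Adj u v) (hu : w ≠ u) (hv : w ≠ v) :
    φ.vertexPos w ∉ φ.edgeArc u v h '' Icc 0 1 := by
  rintro ⟨t, ht, htw⟩
  rcases ht.1.eq_or_lt with rfl | h0
  · exact hu (φ.vertexInj (by rw [← htw, φ.arc_start]))
  rcases ht.2.eq_or_lt with rfl | h1
  · exact hv (φ.vertexInj (by rw [← htw, φ.arc_end]))
  · exact φ.arc_avoid u v h w ⟨t, ⟨h0, h1⟩, htw⟩

/-- A planar graph is a minor of the integer grid. -/
theorem SimpleGraph.IsPlanar.nonempty_gridModel [Finite V] {G : SimpleGraph V}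
    (hG : G.IsPlanar) : Nonempty (GridModel G) := by
  obtain ⟨φ⟩ := hG
  set tail : G.edgeSet → V := fun i => (Quot.out i.1).1 with htail
  set head : G.edgeSet → V := fun i => (Quot.out i.1).2 with hhead
  have hout : ∀ i : G.edgeSet, s(tail i, head i) = i.1 := fun i => Quot.out_eq i.1
  have hadj : ∀ i, G.Adj (tail i) (head i) := fun i => by
    rw [← SimpleGraph.mem_edgeSet, hout]
    exact i.2
  set γ : G.edgeSet → ℝ → ℝ × ℝ := fun i => φ.edgeArc _ _ (hadj i) with hγ
  have hγc : ∀ i, ContinuousOn (γ i) (Icc 0 1) := fun i => φ.arc_cont _ _ _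
  have hcomp : ∀ i, IsCompact (γ i '' Icc 0 1) := fun i =>
    isCompact_Icc.image_of_continuousOn (hγc i)
  obtain ⟨r, hr, hr1, hr2⟩ : ∃ r : ℝ, 0 < r ∧
      (∀ u v, u ≠ v → Disjoint (Metric.closedBall (φ.vertexPos u) r)
        (Metric.closedBall (φ.vertexPos v) r)) ∧
      ∀ i w, w ≠ tail i → w ≠ head i →
        Disjoint (γ i '' Icc 0 1) (Metric.closedBall (φ.vertexPos w) r) := by
    have h1 : ∀ᶠ r in 𝓝[>] (0 : ℝ), ∀ u v, u ≠ v →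
        Disjoint (Metric.closedBall (φ.vertexPos u) r)
          (Metric.closedBall (φ.vertexPos v) r) := by
      simp only [eventually_all]
      exact fun u v huv => eventually_disjoint_closedBall_closedBall (φ.vertexInj.ne huv)
    have h2 : ∀ᶠ r in 𝓝[>] (0 : ℝ), ∀ i w, w ≠ tail i → w ≠ head i →
        Disjoint (γ i '' Icc 0 1) (Metric.closedBall (φ.vertexPos w) r) := by
      simp only [eventually_all]
      exact fun i w hu hv =>
        eventually_disjoint_closedBall (hcomp i).isClosed (φ.vertexPos_notMem (hadj i) hu hv)
    obtain ⟨r, hr, h⟩ := (eventually_mem_nhdsWithin.and (h1.and h2)).exists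
    exact ⟨r, hr, h⟩
  have hsub : ∀ i, ∃ A : Set (ℝ × ℝ), IsCompact A ∧ IsPreconnected A ∧ A ⊆ γ i '' Ioo 0 1 ∧
      (A ∩ Metric.closedBall (φ.vertexPos (tail i)) r).Nonempty ∧
      (A ∩ Metric.closedBall (φ.vertexPos (head i)) r).Nonempty := fun i =>
    exists_subarc (hγc i)
      (by simp only [hγ, φ.arc_start]; exact Metric.closedBall_mem_nhds _ hr)
      (by simp only [hγ, φ.arc_end]; exact Metric.closedBall_mem_nhds _ hr)
  choose A hAc hAp hAγ hAt hAh using hsub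
  set D : V → Set (ℝ × ℝ) := fun v => Metric.closedBall (φ.vertexPos v) r with hD
  have hDc : ∀ v, IsCompact (D v) := fun v => isCompact_closedBall _ _
  obtain ⟨s, hs, hs1, hs2, hs3⟩ : ∃ s : ℝ, 0 < s ∧
      (∀ u v, u ≠ v → Disjoint (cellsMeeting s (D u)) (cellsMeeting s (D v))) ∧
      (∀ i j, i ≠ j → Disjoint (cellsMeeting s (A i)) (cellsMeeting s (A j))) ∧
      ∀ i v, v ≠ tail i → v ≠ head i →
        Disjoint (cellsMeeting s (A i)) (cellsMeeting s (D v)) := by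
    have h1 : ∀ᶠ s in 𝓝[>] (0 : ℝ), ∀ u v, u ≠ v →
        Disjoint (cellsMeeting s (D u)) (cellsMeeting s (D v)) := by
      simp only [eventually_all]
      exact fun u v huv => eventually_disjoint_cellsMeeting (hDc u) (hDc v).isClosed (hr1 u v huv)
    have h2 : ∀ᶠ s in 𝓝[>] (0 : ℝ), ∀ i j, i ≠ j →
        Disjoint (cellsMeeting s (A i)) (cellsMeeting s (A j)) := by
      simp only [eventually_all]
      intro i j hij
      refine eventually_disjoint_cellsMeeting (hAc i) (hAc j).isClosed ?_
      have h := φ.arc_disjoint _ _ (hadj i) _ _ (hadj j) (by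
        rw [hout, hout]
        exact fun h => hij (Subtype.ext h))
      exact (disjoint_iff_inter_eq_empty.2 h).mono (hAγ i)
        ((hAγ j).trans (image_mono Ioo_subset_Icc_self))
    have h3 : ∀ᶠ s in 𝓝[>] (0 : ℝ), ∀ i v, v ≠ tail i → v ≠ head i →
        Disjoint (cellsMeeting s (A i)) (cellsMeeting s (D v)) := by
      simp only [eventually_all]
      exact fun i v hu hv => eventually_disjoint_cellsMeeting (hAc i) (hDc v).isClosed
        ((hr2 i v hu hv).mono_left ((hAγ i).trans (image_mono Ioo_subset_Icc_self)))
    obtain ⟨s, hs, h⟩ := (eventually_mem_nhdsWithin.and (h1.and (h2.and h3))).exists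
    exact ⟨s, hs, h⟩
  have hmeet : ∀ {B C : Set (ℝ × ℝ)}, (B ∩ C).Nonempty →
      (cellsMeeting s B ∩ cellsMeeting s C).Nonempty := by
    rintro B C ⟨x, hB, hC⟩
    obtain ⟨p, hp⟩ := exists_mem_gridCell hs x
    exact ⟨p, ⟨x, hp, hB⟩, x, hp, hC⟩
  refine GridModel.nonempty_of_incidence (tail := tail) (head := head) ?_
    (fun v => finite_cellsMeeting hs (hDc v).isBounded)
    (fun i => finite_cellsMeeting hs (hAc i).isBounded)
    (fun v => cellsMeeting_nonempty hs ⟨_, Metric.mem_closedBall_self hr.le⟩)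
    (fun v => gridConnected_cellsMeeting hs (hDc v).isBounded
      (convex_closedBall _ _).isPreconnected)
    (fun i => gridConnected_cellsMeeting hs (hAc i).isBounded (hAp i)) hs1 hs2 hs3
    (fun i => hmeet (hAt i)) (fun i => hmeet (hAh i)) fun i => (hadj i).ne
  intro u v huv
  exact ⟨⟨s(u, v), huv⟩, Sym2.eq_iff.1 (hout ⟨s(u, v), huv⟩)⟩

end Planar

/-- Grötzsch's theorem: every planar triangle-free graph is 3-colorable. -/
theorem groetzsch [Fintype V] (G : SimpleGraph V)
    (hplanar : G.IsPlanar) (htf : G.CliqueFree 3) : G.Colorable 3 :=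
  hplanar.nonempty_gridModel.some.isMacLane.colorable_three htf
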